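/- Let S = (s_{ij}) be the S-matrix of a modular category: symmetric, with Σ_j s_{i*j}s_{jl} = δ_{il}, and Verlinde matrices N_i := the matrices with (N_i)_{kj} = Σ_m s_{im}s_{km}conj(s_{jm})/s_{0m} having nonnegative integer entries. If an automorphism g of ℂ is applied entrywise, then there is a permutation σ of the index set and signs ε(i) = ±1 such that g(s_{ij}) = ε(i) s_{σ(i)j} = ε(j) s_{iσ(j)} for all i, j. Consequently any two automorphisms of ℂ commute on the field generated by the s_{ij}, so all entries s_{ij} lie in a cyclotomic field. -/

import Mathlib

section
open IsDedekindDomain WithZero NumberField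
open scoped Pointwise

structure LD (M : Type*) [Field M] [Algebra ℚ M] (p : ℕ) where
  v : Valuation M ℤᵐ⁰
  I : Subgroup (M ≃ₐ[ℚ] M)
  φ : M ≃ₐ[ℚ] M
  vI : ∀ σ ∈ I, ∀ x, v (σ x) = v x
  vφ : ∀ x, v (φ x) = v x
  hI : ∀ σ ∈ I, ∀ x, v x ≤ 1 → v (σ x - x) < 1
  hφ : ∀ x, v x ≤ 1 → v (φ x - x ^ p) < 1
  hW : ∀ W ≤ I, ∀ x, x ≠ 0 → (∀ σ ∈ W, σ x = x) → ∃ k : ℤ, v x = exp ((Nat.card W : ℤ) * k)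
  hp : v (p : M) = exp (-(Nat.card I : ℤ))
  π : M
  hπ : v π = exp (-1 : ℤ)
  r : ℕ
  hr0 : r ≠ 0
  hr : ∀ x, v x = 1 → v (x ^ (p ^ r - 1) - 1) < 1

section
variable {M : Type*} [Field M] [NumberField M]
variable (P : HeightOneSpectrum (𝓞 M))

lemma smul_coe (σ : M ≃ₐ[ℚ] M) (x : 𝓞 M) :
    algebraMap (𝓞 M) M (σ • x) = σ (algebraMap (𝓞 M) M x) := by
  rfl

lemma val_stab (σ : M ≃ₐ[ℚ] M) (h : σ ∈ MulAction.stabilizer (M ≃ₐ[ℚ] M) P.asIdeal) (x : M) :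
    P.valuation M (σ x) = P.valuation M x := by
  have key : ∀ r : 𝓞 M, P.intValuation (σ • r) = P.intValuation r := by
    have aux : ∀ σ : M ≃ₐ[ℚ] M, σ ∈ MulAction.stabilizer (M ≃ₐ[ℚ] M) P.asIdeal → ∀ r : 𝓞 M,
        P.intValuation (σ • r) ≤ P.intValuation r := by
      intro σ h r
      by_cases hr : r = 0
      · simp [hr]
      obtain ⟨n, hn⟩ : ∃ n : ℕ, P.intValuation r = exp (-(n : ℤ)) :=
        ⟨_, P.intValuation_eq_exp_neg_multiplicity hr⟩
      rw [hn, P.intValuation_le_pow_iff_mem]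
      have h1 : r ∈ P.asIdeal ^ n := by rw [← P.intValuation_le_pow_iff_mem, hn]
      have h2 : σ • (P.asIdeal ^ n) = P.asIdeal ^ n := by
        rw [Ideal.pointwise_smul_def, Ideal.map_pow, ← Ideal.pointwise_smul_def]
        rw [MulAction.mem_stabilizer_iff.1 h]
      rw [← h2]
      exact Ideal.smul_mem_pointwise_smul _ _ _ h1
    intro r
    refine le_antisymm (aux σ h r) ?_
    have := aux σ⁻¹ (inv_mem h) (σ • r)
    simpa using this
  obtain ⟨a, b, hb, rfl⟩ := IsFractionRing.div_surjective (A := 𝓞 M) x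
  rw [map_div₀, map_div₀, map_div₀, ← smul_coe, ← smul_coe]
  simp only [HeightOneSpectrum.valuation_of_algebraMap, key]

lemma val_inertia (σ : M ≃ₐ[ℚ] M) (h : σ ∈ P.asIdeal.inertia (M ≃ₐ[ℚ] M)) (x : M)
    (hx : P.valuation M x ≤ 1) : P.valuation M (σ x - x) < 1 := by
  obtain ⟨n, d, hnd⟩ := P.exists_primeCompl_mul_eq_of_integer x hx
  have hs := val_stab P σ (Ideal.inertia_le_stabilizer _ h)
  have hd : P.valuation M (algebraMap (𝓞 M) M d) = 1 :=
    P.valuation_eq_one_iff_notMem.2 d.2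
  have hi := fun y : 𝓞 M => (P.valuation_lt_one_iff_mem (K := M) (σ • y - y)).2
    (AddSubgroup.mem_inertia.1 h y)
  have e : (σ x - x) * algebraMap (𝓞 M) M d =
      algebraMap (𝓞 M) M (σ • n - n) - σ x * algebraMap (𝓞 M) M (σ • (d : 𝓞 M) - d) := by
    rw [map_sub, map_sub, smul_coe, smul_coe, ← hnd, map_mul]; ring
  rw [← mul_one (P.valuation M (σ x - x)), ← hd, ← map_mul, e]
  refine Valuation.map_sub_lt _ (hd ▸ hi n) ?_
  rw [hd, map_mul, hs]
  exact (mul_le_of_le_one_left' hx).trans_lt (hi _)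

lemma val_frob (σ : M ≃ₐ[ℚ] M) (p : ℕ) (hp : p.Prime)
    (h : σ ∈ MulAction.stabilizer (M ≃ₐ[ℚ] M) P.asIdeal)
    (h2 : ∀ y : 𝓞 M, σ • y - y ^ p ∈ P.asIdeal) (x : M)
    (hx : P.valuation M x ≤ 1) : P.valuation M (σ x - x ^ p) < 1 := by
  obtain ⟨n, d, hnd⟩ := P.exists_primeCompl_mul_eq_of_integer x hx
  have hs := val_stab P σ h
  have hd : P.valuation M (algebraMap (𝓞 M) M d) = 1 :=
    P.valuation_eq_one_iff_notMem.2 d.2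
  have hi := fun y : 𝓞 M => (P.valuation_lt_one_iff_mem (K := M) (σ • y - y ^ p)).2 (h2 y)
  have e : (σ x - x ^ p) * algebraMap (𝓞 M) M d ^ p =
      algebraMap (𝓞 M) M (σ • n - n ^ p) - σ x * algebraMap (𝓞 M) M (σ • (d : 𝓞 M) - d ^ p) := by
    rw [map_sub, map_sub, smul_coe, smul_coe, map_pow, map_pow, ← hnd, map_mul]; ring
  rw [← mul_one (P.valuation M (σ x - x ^ p)), ← one_pow p, ← hd, ← map_pow, ← map_mul, e]
  refine Valuation.map_sub_lt _ ?_ ?_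
  · simpa [hd] using hi n
  simp only [map_pow, hd, one_pow]
  rw [map_mul, hs]
  exact (mul_le_of_le_one_left' hx).trans_lt (hi _)

lemma val_resid (q : ℕ) (h2 : ∀ y : 𝓞 M, y ^ q - y ∈ P.asIdeal) (hq : 1 ≤ q) (x : M)
    (hx : P.valuation M x = 1) : P.valuation M (x ^ (q - 1) - 1) < 1 := by
  obtain ⟨n, d, hnd⟩ := P.exists_primeCompl_mul_eq_of_integer x hx.le
  have hd : P.valuation M (algebraMap (𝓞 M) M d) = 1 :=
    P.valuation_eq_one_iff_notMem.2 d.2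
  have hi := fun y : 𝓞 M => (P.valuation_lt_one_iff_mem (K := M) (y ^ q - y)).2 (h2 y)
  have e : x * (x ^ (q - 1) - 1) * algebraMap (𝓞 M) M d ^ q =
      algebraMap (𝓞 M) M (n ^ q - n) - x * algebraMap (𝓞 M) M ((d : 𝓞 M) ^ q - d) := by
    rw [map_sub, map_sub, map_pow, map_pow, ← hnd]
    obtain ⟨k, rfl⟩ : ∃ k, q = k + 1 := ⟨q - 1, by omega⟩
    simp only [add_tsub_cancel_right]
    ring
  have : P.valuation M (x ^ (q - 1) - 1) =
      P.valuation M (x * (x ^ (q - 1) - 1) * algebraMap (𝓞 M) M d ^ q) := by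
    simp [map_mul, hx, hd]
  rw [this, e]
  refine Valuation.map_sub_lt _ (hi n) ?_
  rw [map_mul, hx, one_mul]
  exact hi _
end

end

section
open IsDedekindDomain WithZero NumberField
open scoped Pointwise

section
variable {M : Type*} [Field M] [NumberField M]

lemma val_tower {A K G : Type*} [CommRing A] [IsDedekindDomain A] [Field K] [Algebra A K]
    [IsFractionRing A K] [Algebra A (𝓞 M)] [Algebra K M] [Algebra A M] [IsScalarTower A K M]
    [IsScalarTower A (𝓞 M) M] [Module.IsTorsionFree A (𝓞 M)] [Algebra.IsIntegral A (𝓞 M)]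
    [Module.Finite A (𝓞 M)]
    [Group G] [Finite G] [MulSemiringAction G (𝓞 M)]
    [IsGaloisGroup G A (𝓞 M)] (P : HeightOneSpectrum (𝓞 M)) (v : HeightOneSpectrum A)
    [P.asIdeal.LiesOver v.asIdeal] [Finite (A ⧸ v.asIdeal)] (x : K) :
    v.valuation K x ^ (Nat.card (P.asIdeal.inertia G)) = P.valuation M (algebraMap K M x) := by
  rw [← HeightOneSpectrum.valuation_liesOver M v P x]
  congr 1
  have : v.asIdeal.IsMaximal := v.isMaximal
  have : Finite v.asIdeal.ResidueField := by
    have := (Ideal.bijective_algebraMap_quotient_residueField v.asIdeal).2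
    exact Finite.of_surjective _ this
  have : PerfectField v.asIdeal.ResidueField := inferInstance
  rw [Ideal.card_inertia_eq_ramificationIdxIn v.asIdeal P.asIdeal,
    Ideal.ramificationIdxIn_eq_ramificationIdx v.asIdeal P.asIdeal G,
    Ideal.ramificationIdx'_eq_ramificationIdx _ _ v.ne_bot]

variable (P : HeightOneSpectrum (𝓞 M)) 

lemma val_fixed [IsGalois ℚ M] (W : Subgroup (M ≃ₐ[ℚ] M)) (hW : W ≤ P.asIdeal.inertia (M ≃ₐ[ℚ] M))
    (x : M) (hx0 : x ≠ 0) (hx : ∀ σ ∈ W, σ x = x) :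
    ∃ k : ℤ, P.valuation M x = exp ((Nat.card W : ℤ) * k) := by
  let E : IntermediateField ℚ M := FixedPoints.intermediateField W
  have : NumberField E := ⟨⟩
  have hG : IsGaloisGroup W E M := inferInstance
  have hd : SMulDistribClass W (𝓞 M) M := ⟨fun g r m => smul_distrib_smul (g : M ≃ₐ[ℚ] M) r m⟩
  have hG2 : IsGaloisGroup W (𝓞 E) (𝓞 M) :=
    IsGaloisGroup.of_isFractionRing W (𝓞 E) (𝓞 M) E M
  let v : HeightOneSpectrum (𝓞 E) := HeightOneSpectrum.under (𝓞 E) P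
  have hl : P.asIdeal.LiesOver v.asIdeal := ⟨rfl⟩
  have hc : Nat.card (P.asIdeal.inertia W) = Nat.card W := by
    have : P.asIdeal.inertia W = ⊤ := by
      rw [eq_top_iff]
      intro σ _
      exact fun y => hW σ.2 y
    rw [this]
    exact Nat.card_congr (Subgroup.topEquiv).toEquiv
  have hf : Finite (𝓞 E ⧸ v.asIdeal) := Ideal.finiteQuotientOfFreeOfNeBot _ v.ne_bot
  have key := val_tower (G := W) P v (⟨x, fun σ => hx σ σ.2⟩ : E)
  rw [hc] at key
  change _ = P.valuation M x at key
  have h0 : v.valuation E (⟨x, fun σ => hx σ σ.2⟩ : E) ≠ 0 := by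
    rw [Valuation.ne_zero_iff]
    intro h
    exact hx0 (congrArg Subtype.val h)
  refine ⟨log (v.valuation E (⟨x, fun σ => hx σ σ.2⟩ : E)), ?_⟩
  rw [← key]
  conv_lhs => rw [← exp_log h0]
  rw [← exp_nsmul]
  simp

lemma val_p [IsGalois ℚ M] (p : ℕ) (hp : p.Prime) (hP : (p : 𝓞 M) ∈ P.asIdeal) :
    P.valuation M (p : M) = exp (-(Nat.card (P.asIdeal.inertia (M ≃ₐ[ℚ] M)) : ℤ)) := by
  have hpp : Prime (p : ℤ) := Nat.prime_iff_prime_int.1 hp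
  let v : HeightOneSpectrum ℤ := ⟨Ideal.span {(p : ℤ)}, (Ideal.span_singleton_prime hpp.ne_zero).2 hpp,
    by simpa using hp.ne_zero⟩
  have hl : P.asIdeal.LiesOver v.asIdeal := by
    constructor
    have : v.asIdeal.IsMaximal := v.isMaximal
    refine this.eq_of_le ?_ ?_
    · exact (P.isPrime.under ℤ).ne_top
    · rw [Ideal.span_singleton_le_iff_mem, Ideal.mem_comap]
      simpa using hP
  have hf : Finite (ℤ ⧸ v.asIdeal) := Ideal.finiteQuotientOfFreeOfNeBot _ v.ne_bot
  have key := val_tower (A := ℤ) (K := ℚ) (G := M ≃ₐ[ℚ] M) P v (p : ℚ)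
  rw [map_natCast (algebraMap ℚ M)] at key
  rw [← key]
  have : v.valuation ℚ (p : ℚ) = exp (-1 : ℤ) := by
    have := v.valuation_of_algebraMap (K := ℚ) (p : ℤ)
    change v.valuation ℚ (algebraMap ℤ ℚ (p : ℤ)) = _ at this
    rw [show algebraMap ℤ ℚ (p : ℤ) = (p : ℚ) by simp] at this
    rw [this]
    exact v.intValuation_singleton hpp.ne_zero rfl
  rw [this, ← exp_nsmul]
  simp

lemma exists_LD [IsGalois ℚ M] (p : ℕ) (hp : p.Prime) (hP : (p : 𝓞 M) ∈ P.asIdeal) :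
    ∃ L : LD M p, L.v = P.valuation M ∧ L.I = P.asIdeal.inertia (M ≃ₐ[ℚ] M) := by
  have hf : Finite (𝓞 M ⧸ P.asIdeal) := Ideal.finiteQuotientOfFreeOfNeBot _ P.ne_bot
  obtain ⟨φ, hφ⟩ := IsArithFrobAt.exists_of_isInvariant ℤ (M ≃ₐ[ℚ] M) P.asIdeal
  have hunder : P.asIdeal.under ℤ = Ideal.span {(p : ℤ)} := by
    have hpp : Prime (p : ℤ) := Nat.prime_iff_prime_int.1 hp
    have : (Ideal.span {(p : ℤ)}).IsMaximal := 
      ((Ideal.span_singleton_prime hpp.ne_zero).2 hpp).isMaximal (by simpa using hp.ne_zero)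
    refine (this.eq_of_le ?_ ?_).symm
    · exact (P.isPrime.under ℤ).ne_top
    · rw [Ideal.span_singleton_le_iff_mem, Ideal.mem_comap]
      simpa using hP
  have hcard : Nat.card (ℤ ⧸ P.asIdeal.under ℤ) = p := by
    rw [hunder]
    have := Nat.card_congr (Int.quotientSpanNatEquivZMod p).toEquiv
    rw [this]; simp
  have hφ' : ∀ y : 𝓞 M, φ • y - y ^ p ∈ P.asIdeal := by
    intro y
    have := hφ y
    rwa [hcard] at this
  have hfin : ∃ r : ℕ, r ≠ 0 ∧ ∀ y : 𝓞 M, y ^ (p ^ r) - y ∈ P.asIdeal := by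
    have : P.asIdeal.IsMaximal := P.isMaximal
    let : Field (𝓞 M ⧸ P.asIdeal) := Ideal.Quotient.field _
    let := Fintype.ofFinite (𝓞 M ⧸ P.asIdeal)
    have hch : CharP (𝓞 M ⧸ P.asIdeal) p := by
      have : ((p : ℕ) : 𝓞 M ⧸ P.asIdeal) = 0 := by
        rw [← map_natCast (Ideal.Quotient.mk P.asIdeal)]
        exact Ideal.Quotient.eq_zero_iff_mem.2 hP
      exact (CharP.charP_iff_prime_eq_zero hp).2 this
    obtain ⟨n, -, hn⟩ := FiniteField.card (𝓞 M ⧸ P.asIdeal) p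
    refine ⟨n, n.ne_zero, fun y => ?_⟩
    rw [← Ideal.Quotient.mk_eq_mk_iff_sub_mem, map_pow, ← hn, FiniteField.pow_card]
  obtain ⟨r, hr0, hr⟩ := hfin
  obtain ⟨π, hπ⟩ := P.valuation_exists_uniformizer M
  exact ⟨⟨P.valuation M, P.asIdeal.inertia (M ≃ₐ[ℚ] M), φ, 
    fun σ h x => val_stab P σ (Ideal.inertia_le_stabilizer _ h) x,
    fun x => val_stab P φ hφ.mem_stabilizer x,
    fun σ h x hx => val_inertia P σ h x hx,
    fun x hx => val_frob P φ p hp hφ.mem_stabilizer hφ' x hx,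
    fun W hW x hx0 hx => val_fixed P W hW x hx0 hx,
    val_p P p hp hP, π, hπ, r, hr0, fun x hx => val_resid P _ hr (Nat.one_le_pow _ _ hp.pos) x hx⟩, rfl, rfl⟩
end

end

section
open WithZero

namespace VL
variable {M : Type*} [Field M] (v : Valuation M ℤᵐ⁰)

lemma v_nat_le (n : ℕ) : v (n : M) ≤ 1 := by
  induction n with
  | zero => simp
  | succ n ih =>
    push_cast
    exact (v.map_add _ _).trans (max_le ih (by simp))

lemma v_int_le (n : ℤ) : v (n : M) ≤ 1 := by
  obtain ⟨m, rfl | rfl⟩ := n.eq_nat_or_neg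
  · simpa using v_nat_le v m
  · simpa using v_nat_le v m

lemma add_le {x y : M} {c : ℤᵐ⁰} (hx : v x ≤ c) (hy : v y ≤ c) : v (x + y) ≤ c :=
  (v.map_add _ _).trans (max_le hx hy)
lemma sub_le {x y : M} {c : ℤᵐ⁰} (hx : v x ≤ c) (hy : v y ≤ c) : v (x - y) ≤ c :=
  (v.map_sub _ _).trans (max_le hx hy)
lemma mul_le1 {x y : M} (hx : v x ≤ 1) (hy : v y ≤ 1) : v (x * y) ≤ 1 := by
  rw [map_mul]; exact mul_le_one' hx hy
lemma pow_le1 {x : M} (hx : v x ≤ 1) (n : ℕ) : v (x ^ n) ≤ 1 := by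
  rw [map_pow]; exact pow_le_one' hx n

/-- congruence transitivity -/
lemma tr {x y z : M} (h1 : v (x - y) < 1) (h2 : v (y - z) < 1) : v (x - z) < 1 := by
  have : x - z = (x - y) + (y - z) := by ring
  rw [this]; exact v.map_add_lt h1 h2
lemma sy {x y : M} (h1 : v (x - y) < 1) : v (y - x) < 1 := by
  rwa [← v.map_neg, neg_sub]
lemma le_of {x y : M} (h1 : v (x - y) < 1) (hy : v y ≤ 1) : v x ≤ 1 := by
  have : x = (x - y) + y := by ring
  rw [this]; exact add_le v h1.le hy
lemma mulc {x y x' y' : M} (h1 : v (x - y) < 1) (h2 : v (x' - y') < 1) (hy : v y ≤ 1)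
    (hy' : v y' ≤ 1) :
    v (x * x' - y * y') < 1 := by
  have : x * x' - y * y' = (x - y) * x' + y * (x' - y') := by ring
  have hx' := le_of v h2 hy'
  rw [this]
  refine v.map_add_lt ?_ ?_
  · rw [map_mul]; exact (mul_le_of_le_one_right' hx').trans_lt h1
  · rw [map_mul]; exact (mul_le_of_le_one_left' hy).trans_lt h2
lemma powc {x y : M} (h1 : v (x - y) < 1) (hy : v y ≤ 1) (n : ℕ) :
    v (x ^ n - y ^ n) < 1 := by
  induction n with
  | zero => simp
  | succ n ih => 
    rw [pow_succ, pow_succ]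
    exact mulc v ih h1 (pow_le1 v hy n) hy
lemma eq_one_of {x : M} (h1 : v (x - 1) < 1) : v x = 1 := by
  have : x = (x - 1) + 1 := by ring
  rw [this, v.map_add_eq_of_lt_right (by simpa using h1), map_one]

lemma mul_lt1 {x y : M} (hx : v x ≤ 1) (hy : v y < 1) : v (x * y) < 1 := by
  rw [map_mul]; exact (mul_le_of_le_one_left' hx).trans_lt hy

lemma pow_lt1 {x : M} (hx : v x < 1) {n : ℕ} (hn : n ≠ 0) : v (x ^ n) < 1 := by
  rw [map_pow]
  exact pow_lt_one₀ (zero_le) hx hn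

lemma lt1_of_pow {x : M} {n : ℕ} (hx : v (x ^ n) < 1) : v x < 1 := by
  by_contra h
  rw [map_pow] at hx
  exact absurd (one_le_pow₀ (not_lt.1 h) (n := n)) (not_le.2 hx)

lemma one_add_pow (z : M) (hz : v z ≤ 1) (k : ℕ) :
    ∃ r, v r ≤ 1 ∧ (1 + z) ^ k = 1 + k * z + z ^ 2 * r := by
  induction k with
  | zero => exact ⟨0, by simp, by simp⟩
  | succ k ih =>
    obtain ⟨r, hr, h⟩ := ih
    refine ⟨k + r + z * r, add_le v (add_le v (v_nat_le v k) hr) (mul_le1 v hz hr), ?_⟩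
    rw [pow_succ, h]; push_cast; ring

lemma one_add_pow_p (p : ℕ) (hp : p.Prime) (z : M) (hz : v z ≤ 1) :
    ∃ r, v r ≤ 1 ∧ (1 + z) ^ p = 1 + z ^ p + p * z * r := by
  obtain ⟨r, hr⟩ := exists_add_pow_prime_eq (R := v.integer) hp 1 ⟨z, hz⟩
  refine ⟨r, r.2, ?_⟩
  have := congrArg Subtype.val hr
  simpa using this

variable {p : ℕ} [hpf : Fact p.Prime] (hvp : v (p : M) < 1)
include hvp

lemma add_pow_p (x y : M) (hx : v x ≤ 1) (hy : v y ≤ 1) :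
    v ((x + y) ^ p - (x ^ p + y ^ p)) < 1 := by
  obtain ⟨r, hr⟩ := exists_add_pow_prime_eq (R := v.integer) hpf.out ⟨x, hx⟩ ⟨y, hy⟩
  have := congrArg Subtype.val hr
  simp only [Subring.coe_pow, Subring.coe_add, Subring.coe_mul, Subring.coe_natCast] at this
  rw [this, show x ^ p + y ^ p + p * x * y * r - (x ^ p + y ^ p) = (x * y * r) * p by ring]
  exact mul_lt1 v (mul_le1 v (mul_le1 v hx hy) r.2) hvp

lemma int_lt_iff (n : ℤ) : v (n : M) < 1 ↔ (p : ℤ) ∣ n := by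
  constructor
  · intro h
    by_contra hn
    have hco : IsCoprime (p : ℤ) n := 
      (Nat.prime_iff_prime_int.1 hpf.out).coprime_iff_not_dvd.2 hn
    obtain ⟨a, b, hab⟩ := hco
    have : v ((a * p + b * n : ℤ) : M) < 1 := by
      push_cast
      exact v.map_add_lt (mul_lt1 v (v_int_le v a) hvp) (mul_lt1 v (v_int_le v b) h)
    rw [hab] at this
    simp at this
  · rintro ⟨k, rfl⟩
    push_cast
    rw [mul_comm]
    exact mul_lt1 v (v_int_le v k) hvp

lemma nat_lt_iff (n : ℕ) : v (n : M) < 1 ↔ p ∣ n := by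
  have := int_lt_iff v hvp n
  rw [Int.cast_natCast] at this
  rw [this]; exact Int.natCast_dvd_natCast

lemma nat_eq_one {n : ℕ} (h : ¬ p ∣ n) : v (n : M) = 1 :=
  le_antisymm (v_nat_le v n) (not_lt.1 (by rwa [nat_lt_iff v hvp]))

lemma exists_int (x : M) (hx : v x ≤ 1) (h : v (x ^ p - x) < 1) : ∃ j : ℕ, v (x - j) < 1 := by
  -- work in the residue field
  let R := v.valuationSubring
  let k := IsLocalRing.ResidueField R
  have key : ∀ y : R, IsLocalRing.residue R y = 0 ↔ v (y : M) < 1 := by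
    intro y
    rw [IsLocalRing.residue_eq_zero_iff, ← Valuation.mem_maximalIdeal_iff]
  have hch : CharP k p := by
    refine (CharP.charP_iff_prime_eq_zero hpf.out).2 ?_
    rw [← map_natCast (IsLocalRing.residue R), key]
    simpa using hvp
  let t : k := IsLocalRing.residue R ⟨x, hx⟩
  have ht : t ^ p = t := by
    rw [← sub_eq_zero, ← map_pow, ← map_sub, key]
    simpa using h
  rw [← Subfield.mem_bot_iff_pow_eq_self k p, ← ZMod.fieldRange_castHom_eq_bot p] at ht
  obtain ⟨a, ha⟩ := ht
  refine ⟨a.val, ?_⟩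
  have ha' : ((a.val : ℕ) : k) = t := by
    rw [← ha]
    rw [ZMod.castHom_apply, ZMod.natCast_val]
  have h4 := (key (⟨x, hx⟩ - (a.val : ℕ))).1 (by
    rw [map_sub, map_natCast, ha', sub_self])
  exact h4
end VL

end

section
open WithZero
set_option linter.unusedSectionVars false

namespace LD
open VL
variable {M : Type*} [Field M] [Algebra ℚ M] [FiniteDimensional ℚ M] {p : ℕ} [hpf : Fact p.Prime]
  (L : LD M p)

lemma hvp : L.v (p : M) < 1 := by
  rw [L.hp, ← exp_zero, exp_lt_exp]
  have : 0 < Nat.card L.I := Nat.card_pos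
  omega

lemma unit_div {σ : M ≃ₐ[ℚ] M} (hσ : σ ∈ L.I) {u : M} (hu : L.v u = 1) :
    L.v (σ u / u - 1) < 1 := by
  have hu0 : u ≠ 0 := by rintro rfl; simp at hu
  have : σ u / u - 1 = (σ u - u) / u := by field_simp
  rw [this, map_div₀, hu, div_one]
  exact L.hI σ hσ u hu.le

lemma v_div {σ : M ≃ₐ[ℚ] M} (hσ : σ ∈ L.I) {y : M} (hy : y ≠ 0) : L.v (σ y / y) = 1 := by
  rw [map_div₀, L.vI σ hσ, div_self]
  simpa using hy

lemma exists_int_div (hc : ∀ a b : M ≃ₐ[ℚ] M, a * b = b * a)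
    {σ : M ≃ₐ[ℚ] M} (hσ : σ ∈ L.I) {y : M} (hy : y ≠ 0) :
    ∃ j : ℕ, L.v (σ y / y - j) < 1 := by
  have h1 := L.v_div hσ hy
  refine exists_int L.v L.hvp _ h1.le ?_
  have hcomm : ∀ x, L.φ (σ x) = σ (L.φ x) := fun x => by
    have := congrArg (fun g : M ≃ₐ[ℚ] M => g x) (hc L.φ σ)
    simpa using this
  have hu : L.v (L.φ y / y) = 1 := by
    rw [map_div₀, L.vφ, div_self]
    simpa using hy
  have hφy : L.φ y ≠ 0 := by simpa using hy
  have hσy : σ y ≠ 0 := by simpa using hy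
  have hσφy : σ (L.φ y) ≠ 0 := by simpa using hy
  have h2 : L.φ (σ y / y) = (σ (L.φ y / y) / (L.φ y / y)) * (σ y / y) := by
    rw [map_div₀, map_div₀, hcomm]
    field_simp
  have h3 := L.hφ _ h1.le
  have h4 := mulc L.v (L.unit_div hσ hu) (show L.v (σ y / y - σ y / y) < 1 by simp)
    (by simp) h1.le
  rw [← h2, one_mul] at h4
  exact tr _ (sy _ h3) h4

/-- reduction -/
noncomputable def red (x : M) : ZMod p := by
  classical
  exact if h : ∃ j : ℕ, L.v (x - j) < 1 then ((h.choose : ℕ) : ZMod p) else 0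

lemma red_eq {x : M} {j : ℕ} (h : L.v (x - j) < 1) : L.red x = j := by
  have h' : ∃ j : ℕ, L.v (x - j) < 1 := ⟨j, h⟩
  rw [red, dif_pos h']
  have h2 := tr _ (sy _ h'.choose_spec) h
  have e : ((h'.choose : ℕ) : M) - (j : M) = (((h'.choose : ℤ) - (j : ℤ) : ℤ) : M) := by
    push_cast; rfl
  rw [e, int_lt_iff L.v L.hvp, ← ZMod.intCast_zmod_eq_zero_iff_dvd] at h2
  push_cast at h2
  exact sub_eq_zero.1 h2

lemma red_eq_one {x : M} (hx : ∃ j : ℕ, L.v (x - j) < 1) : L.red x = 1 ↔ L.v (x - 1) < 1 := by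
  constructor
  · intro h
    obtain ⟨j, hj⟩ := hx
    have h1 := L.red_eq hj
    rw [h] at h1
    have : (p : ℤ) ∣ (j - 1 : ℤ) := by
      rw [← ZMod.intCast_zmod_eq_zero_iff_dvd]; push_cast; rw [← h1, sub_self]
    rw [← int_lt_iff L.v L.hvp] at this
    push_cast at this
    exact tr _ hj this
  · intro h
    have := L.red_eq (x := x) (j := 1) (by simpa using h)
    simpa using this

noncomputable def theta (hc : ∀ a b : M ≃ₐ[ℚ] M, a * b = b * a) (y : M) (hy : y ≠ 0) :
    L.I →* ZMod p where
  toFun σ := L.red ((σ : M ≃ₐ[ℚ] M) y / y)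
  map_one' := by
    have := L.red_eq (x := (1 : M)) (j := 1) (by simp)
    simpa [hy] using this
  map_mul' σ τ := by
    obtain ⟨j, hj⟩ := L.exists_int_div hc σ.2 hy
    obtain ⟨k, hk⟩ := L.exists_int_div hc τ.2 hy
    rw [L.red_eq hj, L.red_eq hk, ← Nat.cast_mul]
    apply L.red_eq
    have hσy : (σ : M ≃ₐ[ℚ] M) y ≠ 0 := by simpa using hy
    have h1 : ((σ * τ : L.I) : M ≃ₐ[ℚ] M) y / y =
        (σ : M ≃ₐ[ℚ] M) y / y * ((σ : M ≃ₐ[ℚ] M) ((τ : M ≃ₐ[ℚ] M) y / y)) := by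
      rw [map_div₀]
      simp only [Subgroup.coe_mul, AlgEquiv.mul_apply]
      field_simp
    rw [h1]
    push_cast
    refine mulc _ hj ?_ (v_nat_le _ _) (v_nat_le _ _)
    exact tr _ (L.hI σ σ.2 _ (L.v_div τ.2 hy).le) hk

def Gy (y : M) : Subgroup (M ≃ₐ[ℚ] M) where
  carrier := {σ | σ ∈ L.I ∧ L.v (σ y - y) < L.v y ∨ σ = 1}
  mul_mem' := by
    rintro σ τ (⟨h1, h2⟩ | rfl) (⟨h3, h4⟩ | rfl)
    · refine Or.inl ⟨mul_mem h1 h3, ?_⟩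
      rw [AlgEquiv.mul_apply]
      have : σ (τ y) - y = σ (τ y - y) + (σ y - y) := by rw [map_sub]; ring
      rw [this]
      refine L.v.map_add_lt ?_ h2
      rwa [L.vI σ h1]
    · left; simpa using ⟨h1, h2⟩
    · left; simpa using ⟨h3, h4⟩
    · right; simp
  one_mem' := Or.inr rfl
  inv_mem' := by
    rintro σ (⟨h1, h2⟩ | rfl)
    · refine Or.inl ⟨inv_mem h1, ?_⟩
      have : L.v (σ⁻¹ y - y) = L.v (σ y - y) := by
        rw [← L.vI σ h1 (σ⁻¹ y - y), map_sub]
        have : σ (σ⁻¹ y) = y := σ.apply_symm_apply y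
        rw [this, ← L.v.map_neg]
        simp
      rwa [this]
    · right; simp

lemma Gy_le (y : M) : L.Gy y ≤ L.I := by
  rintro σ (h | rfl)
  · exact h.1
  · exact one_mem _

lemma mem_Gy {y : M} (hy : y ≠ 0) {σ : M ≃ₐ[ℚ] M} (hσ : σ ∈ L.I) :
    σ ∈ L.Gy y ↔ L.v (σ y / y - 1) < 1 := by
  have e : σ y / y - 1 = (σ y - y) / y := by field_simp
  have hv : 0 < L.v y := by simpa [zero_lt_iff] using hy
  have : L.v (σ y / y - 1) < 1 ↔ L.v (σ y - y) < L.v y := by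
    rw [e, map_div₀, div_lt_one₀ hv]
  rw [this]
  constructor
  · rintro (h | rfl)
    · exact h.2
    · simpa using hv
  · intro h; exact Or.inl ⟨hσ, h⟩

lemma card_I_le (hc : ∀ a b : M ≃ₐ[ℚ] M, a * b = b * a) {y : M} (hy : y ≠ 0) :
    Nat.card L.I ≤ (p - 1) * Nat.card (L.Gy y) := by
  let f := (L.theta hc y hy).toHomUnits
  have hk : f.ker.map L.I.subtype = L.Gy y := by
    ext σ
    rw [Subgroup.mem_map]
    constructor
    · rintro ⟨τ, hτ, rfl⟩
      change _ ∈ L.Gy y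
      rw [Subgroup.subtype_apply, L.mem_Gy hy τ.2]
      rw [MonoidHom.mem_ker] at hτ
      rw [← L.red_eq_one (L.exists_int_div hc τ.2 hy)]
      exact congrArg Units.val hτ
    · intro h
      have h' := L.Gy_le y h
      refine ⟨⟨σ, h'⟩, ?_, rfl⟩
      rw [MonoidHom.mem_ker]
      ext
      rw [L.mem_Gy hy h', ← L.red_eq_one (L.exists_int_div hc h' hy)] at h
      exact h
  have h1 : Nat.card (L.Gy y) = Nat.card f.ker := by
    rw [← hk]
    exact Nat.card_congr (f.ker.equivMapOfInjective _ L.I.subtype_injective).toEquiv.symm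
  rw [h1, ← Subgroup.index_mul_card f.ker, Subgroup.index_ker]
  refine Nat.mul_le_mul_right _ ?_
  have := Subgroup.card_le_card_group f.range
  rwa [Nat.card_eq_fintype_card (α := (ZMod p)ˣ), ZMod.card_units p] at this

lemma wild_trivial {σ : M ≃ₐ[ℚ] M} (hσ : σ ∈ L.Gy L.π) (l : ℕ) (hl : ¬ p ∣ l) (h1 : σ ^ l = 1) :
    σ = 1 := by
  have hπ0 : L.π ≠ 0 := by intro h; have := L.hπ; rw [h, map_zero] at this; exact exp_ne_zero this.symm
  have hI := L.Gy_le _ hσ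
  have hc1 := (L.mem_Gy hπ0 hI).1 hσ
  have key : ∀ n : ℕ, ∀ x, L.v x ≤ 1 → L.v (σ x - x) ≤ L.v L.π ^ (n + 1) := by
    have hlt : ∀ a, L.v a < 1 → L.v a ≤ L.v L.π := by
      intro a ha
      rw [L.hπ]
      by_cases h0 : L.v a = 0
      · rw [h0]; exact zero_le
      · rw [← exp_log h0] at ha ⊢
        rw [← exp_zero, exp_lt_exp] at ha
        rw [exp_le_exp]; omega
    intro n
    induction n with
    | zero => intro x hx; simpa using hlt _ (L.hI σ hI x hx)
    | succ n ih =>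
      intro x hx
      let t := L.π ^ (n + 1)
      have ht0 : t ≠ 0 := pow_ne_zero _ hπ0
      have hσt0 : σ t ≠ 0 := by simpa using ht0
      let y := (σ x - x) / t
      have hvt : L.v t = L.v L.π ^ (n + 1) := map_pow _ _ _
      have hvt0 : 0 < L.v t := by simpa [zero_lt_iff] using ht0
      have hy : L.v y ≤ 1 := by
        rw [map_div₀, hvt]
        exact div_le_one_of_le₀ (ih x hx) zero_le
      have hxy : σ x = x + t * y := by simp only [y]; field_simp; ring
      have hσt : L.v (σ t / t - 1) < 1 := by
        have : σ t / t = (σ L.π / L.π) ^ (n + 1) := by simp [t, div_pow]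
        rw [this]
        have := powc L.v hc1 (by simp) (n + 1)
        rwa [one_pow] at this
      -- σ^m x = x + t * (m y + small)
      have hm : ∀ m : ℕ, ∃ e, L.v e < 1 ∧ (σ ^ m) x = x + t * (m * y + e) := by
        intro m
        induction m with
        | zero => exact ⟨0, by simp, by simp⟩
        | succ m ihm =>
          obtain ⟨e, he, h⟩ := ihm
          refine ⟨(σ t / t) * σ (m * y + e) - (m * y), ?_, ?_⟩
          · have hs : L.v (m * y + e - m * y) < 1 := by simpa using he
            have hmy : L.v (m * y) ≤ 1 := mul_le1 _ (v_nat_le _ _) hy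
            have := mulc L.v hσt (tr _ (L.hI σ hI _ (le_of _ hs hmy)) hs) (by simp) hmy
            rwa [one_mul] at this
          · rw [pow_succ', AlgEquiv.mul_apply, h, map_add, hxy, map_mul]
            push_cast
            field_simp
            ring
      obtain ⟨e, he, h⟩ := hm l
      rw [h1] at h
      have h5 : l * y + e = 0 := by
        have : t * (l * y + e) = 0 := by simpa using h
        simpa [ht0] using this
      have h6 : L.v y < 1 := by
        have : y = - (e / l) := by
          have : (l : M) ≠ 0 := by
            intro h
            have := nat_eq_one L.v L.hvp hl
            rw [h] at this; simp at this
          field_simp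
          linear_combination h5
        rw [this, L.v.map_neg, map_div₀, nat_eq_one L.v L.hvp hl, div_one]
        exact he
      have : σ x - x = t * y := by rw [hxy]; ring
      rw [this, map_mul, hvt, pow_succ _ (n + 1)]
      exact mul_le_mul_right (hlt _ h6) _
  have hfix : ∀ x, L.v x ≤ 1 → σ x = x := by
    intro x hx
    by_contra hne
    have h0 : L.v (σ x - x) ≠ 0 := by simpa [sub_eq_zero] using hne
    have h2 := key (log (L.v (σ x - x))).natAbs x hx
    rw [L.hπ, ← exp_nsmul] at h2
    rw [← exp_log h0, exp_le_exp] at h2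
    simp at h2
    have := neg_abs_le (log (L.v (σ x - x)))
    omega
  ext x
  by_cases hx : L.v x ≤ 1
  · simpa using hfix x hx
  · have h3 := hfix x⁻¹ (by
      rw [map_inv₀]
      exact inv_le_one_of_one_le₀ (not_le.1 hx).le)
    rw [map_inv₀, inv_inj] at h3
    simpa using h3

lemma isPGroup_Gpi : IsPGroup p (L.Gy L.π) := by
  have hne : Nat.card (L.Gy L.π) ≠ 0 := Nat.card_pos.ne'
  refine IsPGroup.of_card (n := _) (Nat.eq_prime_pow_of_unique_prime_dvd hne ?_)
  intro d hd hdvd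
  by_contra hdp
  have : Fact d.Prime := ⟨hd⟩
  obtain ⟨σ, hσ⟩ := exists_prime_orderOf_dvd_card' d hdvd
  have h1 : (σ : M ≃ₐ[ℚ] M) ^ d = 1 := by
    have := pow_orderOf_eq_one σ
    rw [hσ] at this
    exact congrArg Subtype.val this
  have h2 := L.wild_trivial σ.2 d (fun h => hdp ((Nat.prime_dvd_prime_iff_eq hpf.out hd).1 h).symm) h1
  have : σ = 1 := Subtype.ext h2
  rw [this, orderOf_one] at hσ
  exact hd.one_lt.ne hσ
end LD

end

section
open WithZero
set_option linter.unusedSectionVars false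

namespace LD
open VL
variable {M : Type*} [Field M] [Algebra ℚ M] [FiniteDimensional ℚ M] {p : ℕ} [hpf : Fact p.Prime]
  (L : LD M p) {ζ : M} (hζ : IsPrimitiveRoot ζ p)
include hζ

lemma lam_ne : ζ - 1 ≠ 0 := sub_ne_zero.2 (hζ.ne_one hpf.out.one_lt)

lemma v_zeta : L.v ζ = 1 := by
  have h : L.v ζ ^ p = 1 := by rw [← map_pow, hζ.pow_eq_one, map_one]
  exact (pow_eq_one_iff_of_nonneg zero_le hpf.out.ne_zero).1 h

lemma map_lam (σ : M ≃ₐ[ℚ] M) : σ (ζ - 1) = σ ζ - 1 := by rw [map_sub, map_one]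

lemma zeta_modEq {a b : ℕ} (h : a ≡ b [MOD p]) : ζ ^ a = ζ ^ b := by
  rw [pow_eq_pow_mod a hζ.pow_eq_one, pow_eq_pow_mod b hζ.pow_eq_one, h]

lemma v_zeta_pow_sub_le (k : ℕ) : L.v (ζ ^ k - 1) ≤ L.v (ζ - 1) := by
  rw [← mul_geom_sum, map_mul]
  refine mul_le_of_le_one_right' ?_
  refine L.v.map_sum_le ?_
  intro i _
  rw [map_pow, L.v_zeta hζ, one_pow]

lemma v_zeta_pow_sub {k : ℕ} (hk : ¬ p ∣ k) : L.v (ζ ^ k - 1) = L.v (ζ - 1) := by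
  refine le_antisymm (L.v_zeta_pow_sub_le hζ k) ?_
  have hco : k.Coprime p := ((hpf.out.coprime_iff_not_dvd).2 hk).symm
  have h2 := hζ.pow_of_coprime k hco
  obtain ⟨j, -, hj⟩ := h2.eq_pow_of_pow_eq_one hζ.pow_eq_one
  have := L.v_zeta_pow_sub_le h2 j
  rwa [hj] at this

lemma v_lam_pow : L.v (ζ - 1) ^ (p - 1) = L.v (p : M) := by
  obtain ⟨n, rfl⟩ : ∃ n, p = n + 1 := ⟨p - 1, by have := hpf.out.pos; omega⟩
  have := hζ.prod_one_sub_pow_eq_order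
  rw [Nat.cast_succ, ← this, map_prod]
  simp only [add_tsub_cancel_right]
  rw [Finset.prod_congr rfl (g := fun _ => L.v (ζ - 1)), Finset.prod_const, Finset.card_range]
  intro k hk
  rw [← L.v.map_neg, neg_sub]
  apply L.v_zeta_pow_sub hζ
  intro h
  have := Nat.le_of_dvd (by omega) h
  have := Finset.mem_range.1 hk
  omega

lemma v_lam_lt : L.v (ζ - 1) < 1 := by
  refine lt1_of_pow L.v (n := p - 1) ?_
  rw [map_pow, L.v_lam_pow hζ]; exact L.hvp

lemma zeta_pow_c (k : ℕ) : L.v (ζ ^ k - 1) < 1 := 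
  (L.v_zeta_pow_sub_le hζ k).trans_lt (L.v_lam_lt hζ)

lemma geom_c (k : ℕ) : L.v ((ζ ^ k - 1) / (ζ - 1) - k) < 1 := by
  rw [← mul_geom_sum, mul_div_cancel_left₀ _ (lam_ne hζ)]
  induction k with
  | zero => simp
  | succ k ih =>
    rw [Finset.sum_range_succ]
    have : (∑ i ∈ Finset.range k, ζ ^ i + ζ ^ k - ((k + 1 : ℕ) : M)) =
      (∑ i ∈ Finset.range k, ζ ^ i - k) + (ζ ^ k - 1) := by push_cast; ring
    rw [this]
    exact L.v.map_add_lt ih (L.zeta_pow_c hζ k)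

lemma exists_k (σ : M ≃ₐ[ℚ] M) : ∃ k : ℕ, σ ζ = ζ ^ k ∧ ¬ p ∣ k := by
  have h1 : IsPrimitiveRoot (σ ζ) p := hζ.map_of_injective σ.injective
  obtain ⟨k, -, hk⟩ := hζ.eq_pow_of_pow_eq_one h1.pow_eq_one
  refine ⟨k, hk.symm, ?_⟩
  rintro ⟨m, rfl⟩
  rw [pow_mul, hζ.pow_eq_one, one_pow] at hk
  rw [← hk] at h1
  exact h1.ne_one hpf.out.one_lt rfl

lemma mem_W {σ : M ≃ₐ[ℚ] M} : σ ∈ L.Gy (ζ - 1) ↔ σ ∈ L.I ∧ σ ζ = ζ := by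
  constructor
  · intro h
    have hI := L.Gy_le _ h
    refine ⟨hI, ?_⟩
    rw [L.mem_Gy (lam_ne hζ) hI] at h
    obtain ⟨k, hk, -⟩ := exists_k hζ σ
    have h2 := L.geom_c hζ k
    rw [map_lam hζ, hk] at h
    have h3 := tr _ (sy _ h2) h
    have : (p : ℤ) ∣ (k - 1 : ℤ) := by
      rw [← int_lt_iff L.v L.hvp]; push_cast; exact h3
    rw [hk]
    have h4 : k ≡ 1 [MOD p] := ((Nat.modEq_iff_dvd).2 (by simpa using this)).symm
    rw [zeta_modEq hζ h4, pow_one]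
  · rintro ⟨hI, h⟩
    rw [L.mem_Gy (lam_ne hζ) hI, map_lam hζ, h, div_self (lam_ne hζ)]
    simp

lemma card_eq (hc : ∀ a b : M ≃ₐ[ℚ] M, a * b = b * a) :
    Nat.card L.I = (p - 1) * Nat.card (L.Gy (ζ - 1)) ∧
      L.v (ζ - 1) = exp (-(Nat.card (L.Gy (ζ - 1)) : ℤ)) := by
  have h1 := L.card_I_le hc (lam_ne hζ)
  obtain ⟨k, hk⟩ := L.hW (L.Gy (ζ - 1)) (L.Gy_le _) (ζ - 1) (lam_ne hζ) (by
    intro σ hσ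
    rw [map_sub, map_one, ((L.mem_W hζ).1 hσ).2])
  have h2 := L.v_lam_pow hζ
  rw [L.hp, hk, ← exp_nsmul, exp_inj] at h2
  have hw : 0 < Nat.card (L.Gy (ζ - 1)) := Nat.card_pos
  have hi : 0 < Nat.card L.I := Nat.card_pos
  have hp1 : 0 < p - 1 := by have := hpf.out.one_lt; omega
  set w := Nat.card (L.Gy (ζ - 1))
  set i := Nat.card L.I
  set q := p - 1
  simp only [nsmul_eq_mul] at h2
  have hqw : (0 : ℤ) < (q : ℤ) * w := by positivity
  have h1' : (i : ℤ) ≤ (q : ℤ) * w := by exact_mod_cast h1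
  have hk0 : k < 0 := by
    by_contra hk0
    have : 0 ≤ (q : ℤ) * (w * k) := by
      have : 0 ≤ k := by omega
      positivity
    omega
  have hk1 : k = -1 := by
    by_contra hne
    have : k ≤ -2 := by omega
    nlinarith
  subst hk1
  refine ⟨?_, by rw [hk]; simp⟩
  have : (i : ℤ) = (q : ℤ) * w := by linarith
  exact_mod_cast this

lemma W_eq (hc : ∀ a b : M ≃ₐ[ℚ] M, a * b = b * a) : L.Gy (ζ - 1) = L.Gy L.π := by
  have hπ0 : L.π ≠ 0 := by
    intro h; have := L.hπ; rw [h, map_zero] at this; exact exp_ne_zero this.symm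
  obtain ⟨h1, h2⟩ := L.card_eq hζ hc
  have h3 := L.card_I_le hc hπ0
  have hp1 : 0 < p - 1 := by have := hpf.out.one_lt; omega
  symm
  refine Subgroup.eq_of_le_of_card_ge ?_ ?_
  · intro σ hσ
    have hI := L.Gy_le _ hσ
    rw [L.mem_Gy (lam_ne hζ) hI]
    rw [L.mem_Gy hπ0 hI] at hσ
    set w := Nat.card (L.Gy (ζ - 1))
    have hπw : L.π ^ w ≠ 0 := pow_ne_zero _ hπ0
    have hl := lam_ne hζ
    have hu : L.v ((ζ - 1) / L.π ^ w) = 1 := by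
      rw [map_div₀, map_pow, L.hπ, h2, ← exp_nsmul]
      simp
    have hσπ : σ L.π ≠ 0 := by simpa using hπ0
    have e : σ (ζ - 1) / (ζ - 1) =
        (σ ((ζ - 1) / L.π ^ w) / ((ζ - 1) / L.π ^ w)) * (σ L.π / L.π) ^ w := by
      rw [map_div₀, map_pow, div_pow]
      field_simp
    rw [e]
    have := mulc L.v (L.unit_div hI hu) (powc L.v hσ (by simp) w) (by simp) (by simp)
    simpa using this
  · rw [h1] at h3
    exact Nat.le_of_mul_le_mul_left h3 hp1

lemma isPGroup_W (hc : ∀ a b : M ≃ₐ[ℚ] M, a * b = b * a) : IsPGroup p (L.Gy (ζ - 1)) := by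
  rw [L.W_eq hζ hc]; exact L.isPGroup_Gpi

lemma kappa_surj (hc : ∀ a b : M ≃ₐ[ℚ] M, a * b = b * a) (k : ℕ) (hk : ¬ p ∣ k) :
    ∃ δ ∈ L.I, δ ζ = ζ ^ k := by
  obtain ⟨h1, h2⟩ := L.card_eq hζ hc
  let f := (L.theta hc (ζ - 1) (lam_ne hζ)).toHomUnits
  have hf : ∀ σ : L.I, ∀ m : ℕ, (σ : M ≃ₐ[ℚ] M) ζ = ζ ^ m → (f σ : ZMod p) = m := by
    intro σ m hm
    change L.red _ = _
    apply L.red_eq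
    rw [map_lam hζ, hm]
    exact L.geom_c hζ m
  have hk' : f.ker.map L.I.subtype = L.Gy (ζ - 1) := by
    ext σ
    rw [Subgroup.mem_map]
    constructor
    · rintro ⟨τ, hτ, rfl⟩
      rw [Subgroup.subtype_apply, L.mem_Gy (lam_ne hζ) τ.2]
      rw [MonoidHom.mem_ker] at hτ
      rw [← L.red_eq_one (L.exists_int_div hc τ.2 (lam_ne hζ))]
      exact congrArg Units.val hτ
    · intro h
      have h' := L.Gy_le _ h
      refine ⟨⟨σ, h'⟩, ?_, rfl⟩
      rw [MonoidHom.mem_ker]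
      ext
      rw [L.mem_Gy (lam_ne hζ) h', ← L.red_eq_one (L.exists_int_div hc h' (lam_ne hζ))] at h
      exact h
  have h3 : Nat.card (L.Gy (ζ - 1)) = Nat.card f.ker := by
    rw [← hk']
    exact Nat.card_congr (f.ker.equivMapOfInjective _ L.I.subtype_injective).toEquiv.symm
  have h4 : Nat.card f.range = p - 1 := by
    rw [h3, ← Subgroup.index_mul_card f.ker, Subgroup.index_ker] at h1
    exact Nat.eq_of_mul_eq_mul_right Nat.card_pos h1
  have h5 : f.range = ⊤ := by
    apply Subgroup.eq_top_of_card_eq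
    rw [h4, Nat.card_eq_fintype_card, ZMod.card_units p]
  let u : (ZMod p)ˣ := ZMod.unitOfCoprime k ((hpf.out.coprime_iff_not_dvd).2 hk).symm
  obtain ⟨δ, hδ⟩ : u ∈ f.range := by rw [h5]; trivial
  refine ⟨δ, δ.2, ?_⟩
  obtain ⟨m, hm, -⟩ := exists_k hζ (δ : M ≃ₐ[ℚ] M)
  have h6 := hf δ m hm
  rw [hδ] at h6
  simp only [u, ZMod.coe_unitOfCoprime] at h6
  rw [hm]
  exact zeta_modEq hζ ((ZMod.natCast_eq_natCast_iff _ _ _).1 h6).symm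
end LD

end

section
open WithZero
set_option linter.unusedSectionVars false

namespace LD
open VL
variable {M : Type*} [Field M] [Algebra ℚ M] [FiniteDimensional ℚ M] {p : ℕ} [hpf : Fact p.Prime]
  (L : LD M p) {ζ : M} (hζ : IsPrimitiveRoot ζ p) (hc : ∀ a b : M ≃ₐ[ℚ] M, a * b = b * a)

/-- Kummer elements -/
def Ku (ζ x : M) : Prop := x ≠ 0 ∧ ∀ σ ∈ L.Gy (ζ - 1), σ (x ^ p) = x ^ p

include hζ

lemma ku_mul {x : M} (hx : L.Ku ζ x) {σ : M ≃ₐ[ℚ] M} (hσ : σ ∈ L.Gy (ζ - 1)) :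
    ∃ b : ℕ, σ x = ζ ^ b * x := by
  have h := hx.2 σ hσ
  have hx0 := hx.1
  have : (σ x / x) ^ p = 1 := by
    rw [div_pow, ← map_pow, h, div_self (pow_ne_zero _ hx0)]
  obtain ⟨b, -, hb⟩ := hζ.eq_pow_of_pow_eq_one this
  exact ⟨b, by rw [hb]; field_simp⟩

lemma ku_of {x : M} (hx0 : x ≠ 0) (h : ∀ σ ∈ L.Gy (ζ - 1), ∃ b : ℕ, σ x = ζ ^ b * x) :
    L.Ku ζ x := by
  refine ⟨hx0, fun σ hσ => ?_⟩
  obtain ⟨b, hb⟩ := h σ hσ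
  rw [map_pow, hb, mul_pow, ← pow_mul, mul_comm b, pow_mul, hζ.pow_eq_one, one_pow, one_mul]

include hc

lemma fix_le {a : M} (ha : ∀ σ ∈ L.Gy (ζ - 1), σ a = a) (h1 : L.v a < 1) :
    L.v a ≤ L.v (ζ - 1) := by
  by_cases h0 : a = 0
  · rw [h0, map_zero]; exact zero_le
  obtain ⟨k, hk⟩ := L.hW _ (L.Gy_le (ζ - 1)) a h0 ha
  have hw : 0 < Nat.card (L.Gy (ζ - 1)) := Nat.card_pos
  rw [(L.card_eq hζ hc).2, hk]
  rw [hk, ← exp_zero, exp_lt_exp] at h1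
  rw [exp_le_exp]
  have : k < 0 := by
    by_contra h
    have : 0 ≤ k := by omega
    have : 0 ≤ (Nat.card (L.Gy (ζ - 1)) : ℤ) * k := by positivity
    omega
  have hw' : (0 : ℤ) < (Nat.card (L.Gy (ζ - 1)) : ℤ) := by exact_mod_cast hw
  nlinarith

omit hc in
lemma lam_fix {σ : M ≃ₐ[ℚ] M} (hσ : σ ∈ L.Gy (ζ - 1)) : σ (ζ - 1) = ζ - 1 := by
  rw [map_lam hζ, ((L.mem_W hζ).1 hσ).2]

lemma ku_fix {x : M} (hx : L.Ku ζ x) {g : M ≃ₐ[ℚ] M} {k : ℕ} (hg : g ζ = ζ ^ k) :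
    ∀ σ ∈ L.Gy (ζ - 1), σ (g x / x ^ k) = g x / x ^ k := by
  intro σ hσ
  obtain ⟨b, hb⟩ := L.ku_mul hζ hx hσ
  have h1 : σ (g x) = g (σ x) := by
    have := congrArg (fun f : M ≃ₐ[ℚ] M => f x) (hc σ g)
    simpa using this
  have hx0 := hx.1
  have hz : ζ ≠ 0 := hζ.ne_zero hpf.out.ne_zero
  rw [map_div₀, h1, map_pow, hb, map_mul, map_pow, hg, mul_pow, ← pow_mul, ← pow_mul, mul_comm k b]
  rw [mul_div_mul_left _ _ (pow_ne_zero _ hz)]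

omit hc in
lemma pow_bound {e : M} (h : L.v (e - 1) ≤ L.v (ζ - 1)) :
    L.v (e ^ p - 1) ≤ L.v (ζ - 1) ^ p := by
  have hl := L.v_lam_lt hζ
  obtain ⟨r, hr, h2⟩ := one_add_pow_p L.v p hpf.out (e - 1) (h.trans hl.le)
  rw [add_sub_cancel] at h2
  rw [h2, show 1 + (e - 1) ^ p + p * (e - 1) * r - 1 = (e - 1) ^ p + p * (e - 1) * r by ring]
  refine add_le _ ?_ ?_
  · rw [map_pow]; exact pow_le_pow_left₀ zero_le h p
  · rw [map_mul, map_mul, ← L.v_lam_pow hζ]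
    rw [← pow_sub_one_mul hpf.out.ne_zero]
    refine (mul_le_of_le_one_right' hr).trans ?_
    exact mul_le_mul_right h _

lemma Q {x c : M} (hx : L.Ku ζ x) (hx1 : L.v (x - 1) < 1) {g : M ≃ₐ[ℚ] M} {k i : ℕ}
    (hgv : ∀ y, L.v (g y) = L.v y) (hg : g ζ = ζ ^ k) (hgx : L.v (g x - 1) < 1)
    (hi : 1 ≤ i) (hip : i < p) (hcx : x ^ p = 1 + (ζ - 1) ^ i * c) (hcv : L.v c ≤ 1) :
    L.v (k ^ i * g c - k * c) < 1 := by
  have hl := L.v_lam_lt hζ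
  have hl0 := lam_ne hζ
  have hx0 := hx.1
  have hxk0 : x ^ k ≠ 0 := pow_ne_zero _ hx0
  obtain ⟨e, he⟩ : ∃ e, e = g x / x ^ k := ⟨_, rfl⟩
  have hvx : L.v x = 1 := eq_one_of _ hx1
  have he1 : L.v (e - 1) < 1 := by
    have : e - 1 = (g x - x ^ k) / x ^ k := by rw [he]; field_simp
    rw [this, map_div₀, map_pow, hvx, one_pow, div_one]
    refine tr _ hgx (sy _ ?_)
    simpa using powc L.v hx1 (by simp) k
  have he2 : L.v (e - 1) ≤ L.v (ζ - 1) := by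
    refine L.fix_le hζ hc (fun σ hσ => ?_) he1
    rw [map_sub, map_one, he, L.ku_fix hζ hc hx hg σ hσ]
  have he3 := L.pow_bound hζ he2
  have hgx' : g x = e * x ^ k := by rw [he]; field_simp
  have hga : g (x ^ p) = e ^ p * (x ^ p) ^ k := by
    rw [map_pow, hgx', mul_pow, ← pow_mul, ← pow_mul, mul_comm k]
  have hli : L.v ((ζ - 1) ^ i) ≤ 1 := pow_le1 _ hl.le _
  have hli' : L.v ((ζ - 1) ^ i) < 1 := pow_lt1 _ hl (by omega)
  have hli0 : (ζ - 1) ^ i ≠ 0 := pow_ne_zero _ hl0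
  obtain ⟨r, hr, hr2⟩ := one_add_pow L.v ((ζ - 1) ^ i * c) (mul_le1 _ hli hcv) k
  rw [hcx, hr2, map_add, map_one, map_mul, map_pow] at hga
  have hd : (g (ζ - 1) / (ζ - 1)) ^ i * g c - k * c =
      (e ^ p - 1) / (ζ - 1) ^ i * (x ^ p) ^ k + (ζ - 1) ^ i * c ^ 2 * r := by
    rw [hcx, hr2, div_pow]
    field_simp
    linear_combination hga
  have h1 : L.v ((g (ζ - 1) / (ζ - 1)) ^ i * g c - k * c) < 1 := by
    rw [hd]
    refine L.v.map_add_lt ?_ ?_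
    · rw [map_mul, map_pow _ (x ^ p), map_pow _ x, hvx, one_pow, one_pow, mul_one, map_div₀, map_pow]
      rw [div_lt_one₀ (pow_pos (by rw [zero_lt_iff]; simpa using hl0) _)]
      refine he3.trans_lt ?_
      exact pow_lt_pow_right_of_lt_one₀ (by rw [zero_lt_iff]; simpa using hl0) hl hip
    · rw [mul_assoc, mul_comm]
      exact mul_lt1 _ (mul_le1 _ (pow_le1 _ hcv 2) hr) hli'
  have h2 : L.v ((g (ζ - 1) / (ζ - 1)) - k) < 1 := by
    rw [map_lam hζ, hg]; exact L.geom_c hζ k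
  have h3 := mulc L.v (powc L.v h2 (v_nat_le _ _) i) (show L.v (g c - g c) < 1 by simp)
    (pow_le1 _ (v_nat_le _ _) i) (by rw [hgv]; exact hcv)
  exact tr _ (sy _ h3) h1

/-- Step 4 -/
lemma kummer4 {x : M} (hx : L.Ku ζ x) (hx1 : L.v (x - 1) < 1)
    (hp : L.v (x ^ p - 1) ≤ L.v (ζ - 1) ^ p) : ∀ σ ∈ L.Gy (ζ - 1), σ x = x := by
  have hl := L.v_lam_lt hζ
  have hl0 := lam_ne hζ
  have hvl : 0 < L.v (ζ - 1) := by rw [zero_lt_iff]; simpa using hl0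
  have hvx : L.v x = 1 := eq_one_of _ hx1
  have h1 : L.v (x - 1) ≤ L.v (ζ - 1) := by
    by_contra hlt
    rw [not_le] at hlt
    have hj : ∀ j : ℕ, L.v (x - ζ ^ j) = L.v (x - 1) := by
      intro j
      have : x - ζ ^ j = (x - 1) - (ζ ^ j - 1) := by ring
      rw [this]
      exact L.v.map_sub_eq_of_lt_left ((L.v_zeta_pow_sub_le hζ j).trans_lt hlt)
    have hprod : x ^ p - 1 = ∏ j ∈ Finset.range p, (x - ζ ^ j) := by
      have := X_pow_sub_C_eq_prod hζ hpf.out.pos (one_pow (M := M) p)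
      have := congrArg (Polynomial.eval x) this
      simpa [Polynomial.eval_prod] using this
    rw [hprod, map_prod, Finset.prod_congr rfl (fun j _ => hj j), Finset.prod_const,
      Finset.card_range] at hp
    exact absurd (pow_lt_pow_left₀ hlt zero_le hpf.out.ne_zero) (not_lt.2 hp)
  intro σ hσ
  obtain ⟨b, hb⟩ := L.ku_mul hζ hx hσ
  by_cases hpb : p ∣ b
  · obtain ⟨m, rfl⟩ := hpb
    rw [hb, pow_mul, hζ.pow_eq_one, one_pow, one_mul]
  · exfalso
    have hy : L.v ((x - 1) / (ζ - 1)) ≤ 1 := by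
      rw [map_div₀]; exact div_le_one_of_le₀ h1 zero_le
    have h2 := L.hI σ (L.Gy_le _ hσ) _ hy
    have h3 : σ ((x - 1) / (ζ - 1)) - (x - 1) / (ζ - 1) = (ζ ^ b - 1) * x / (ζ - 1) := by
      rw [map_div₀, L.lam_fix hζ hσ, map_sub, map_one, hb]
      field_simp
      ring
    rw [h3, map_div₀, map_mul, L.v_zeta_pow_sub hζ hpb, hvx, mul_one, div_self hvl.ne'] at h2
    exact lt_irrefl _ h2
end LD

end

section
open WithZero
set_option linter.unusedSectionVars false

lemma exists_gen_nat (p : ℕ) [hpf : Fact p.Prime] :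
    ∃ k : ℕ, ¬ p ∣ k ∧ ∀ j : ℕ, 0 < j → j < p - 1 → ¬ (p : ℤ) ∣ (k : ℤ) ^ j - 1 := by
  obtain ⟨g, hg⟩ := IsCyclic.exists_generator (α := (ZMod p)ˣ)
  have ho : orderOf g = p - 1 := by
    rw [orderOf_eq_card_of_forall_mem_zpowers hg, Nat.card_eq_fintype_card, ZMod.card_units]
  have hk : ((ZMod.val (g : ZMod p) : ℕ) : ZMod p) = g := ZMod.natCast_zmod_val _
  refine ⟨ZMod.val (g : ZMod p), ?_, fun j h1 h2 h3 => ?_⟩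
  · rw [← ZMod.natCast_eq_zero_iff, hk]; exact g.ne_zero
  · rw [← ZMod.intCast_zmod_eq_zero_iff_dvd] at h3
    push_cast at h3
    rw [hk, sub_eq_zero] at h3
    have : g ^ j = 1 := by ext; push_cast; exact h3
    have := orderOf_dvd_of_pow_eq_one this
    rw [ho] at this
    exact absurd (Nat.le_of_dvd h1 this) (by omega)

namespace LD
open VL
variable {M : Type*} [Field M] [Algebra ℚ M] [FiniteDimensional ℚ M] {p : ℕ} [hpf : Fact p.Prime]
  (L : LD M p) {ζ : M} (hζ : IsPrimitiveRoot ζ p) (hc : ∀ a b : M ≃ₐ[ℚ] M, a * b = b * a)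

include hζ hc

lemma st_succ {x : M} (hx : L.Ku ζ x) {i : ℕ}
    (h : L.v ((x ^ p - 1) / (ζ - 1) ^ i) < 1) : L.v (x ^ p - 1) ≤ L.v (ζ - 1) ^ (i + 1) := by
  have hl0 := lam_ne hζ
  have hvl : 0 < L.v (ζ - 1) := by rw [zero_lt_iff]; simpa using hl0
  have h1 := L.fix_le hζ hc (fun σ hσ => by
    rw [map_div₀, map_pow σ (ζ - 1), L.lam_fix hζ hσ, map_sub, map_one, hx.2 σ hσ]) h
  rw [map_div₀, map_pow, div_le_iff₀ (pow_pos hvl _)] at h1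
  rwa [pow_succ']

lemma kummer3 (hodd : p ≠ 2) {x : M} (hx : L.Ku ζ x) (hx1 : L.v (x - 1) < 1) (i : ℕ) (hi : 2 ≤ i) (hip : i ≤ p)
    (h2 : L.v (x ^ p - 1) ≤ L.v (ζ - 1) ^ 2) : L.v (x ^ p - 1) ≤ L.v (ζ - 1) ^ i := by
  have hl0 := lam_ne hζ
  have hvl : 0 < L.v (ζ - 1) := by rw [zero_lt_iff]; simpa using hl0
  induction i, hi using Nat.le_induction with
  | base => exact h2
  | succ i hi ih =>
    have ih := ih (by omega)
    refine L.st_succ hζ hc hx ?_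
    obtain ⟨c, hcc⟩ : ∃ c, c = (x ^ p - 1) / (ζ - 1) ^ i := ⟨_, rfl⟩
    rw [← hcc]
    have hvc : L.v c ≤ 1 := by
      rw [hcc, map_div₀, map_pow]; exact div_le_one_of_le₀ ih zero_le
    obtain ⟨k, hk1, hk2⟩ := exists_gen_nat p
    obtain ⟨δ, hδ, hδζ⟩ := L.kappa_surj hζ hc k hk1
    have hq := L.Q hζ hc hx hx1 (L.vI δ hδ) hδζ (by
      have := L.vI δ hδ (x - 1)
      rw [map_sub δ, map_one δ] at this
      rwa [this]) (by omega) (by omega) (show x ^ p = 1 + (ζ - 1) ^ i * c by rw [hcc]; field_simp; ring) hvc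
    have h3 := L.hI δ hδ c hvc
    have h4 : L.v (k ^ i * δ c - k ^ i * c) < 1 := by
      rw [← mul_sub]; exact mul_lt1 _ (pow_le1 _ (v_nat_le _ _) _) h3
    have h5 := tr _ (sy _ h4) hq
    have h6 : (k : M) ^ i * c - k * c = (k : M) * (((k : ℤ) ^ (i - 1) - 1 : ℤ) : M) * c := by
      obtain ⟨i, rfl⟩ : ∃ i', i = i' + 1 := ⟨i - 1, by omega⟩
      push_cast
      ring
    have h7 : L.v ((((k : ℤ) ^ (i - 1) - 1 : ℤ)) : M) = 1 := by
      refine le_antisymm (v_int_le _ _) (not_lt.1 ?_)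
      rw [int_lt_iff L.v L.hvp]
      exact hk2 _ (by omega) (by omega)
    rwa [h6, map_mul, map_mul, h7, nat_eq_one L.v L.hvp hk1, one_mul, one_mul] at h5

lemma kummer2 (hodd : p ≠ 2) {ζ₂ : M} (h2 : ζ₂ ^ p = ζ) (hp2 : ∀ σ ∈ L.Gy (ζ - 1), ∃ b : ℕ, σ ζ₂ = ζ ^ b * ζ₂)
    {x : M} (hx : L.Ku ζ x) (hx1 : L.v (x - 1) < 1) : 
    ∀ σ ∈ L.Gy (ζ - 1), σ ζ₂ = ζ₂ → σ x = x := by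
  have hl := L.v_lam_lt hζ
  have hl0 := lam_ne hζ
  have hvl : 0 < L.v (ζ - 1) := by rw [zero_lt_iff]; simpa using hl0
  obtain ⟨c, hcc⟩ : ∃ c, c = (x ^ p - 1) / (ζ - 1) ^ 1 := ⟨_, rfl⟩
  have ha : L.v (x ^ p - 1) < 1 := by simpa using powc L.v hx1 (by simp) p
  have ha2 : L.v (x ^ p - 1) ≤ L.v (ζ - 1) := L.fix_le hζ hc (fun σ hσ => by
    rw [map_sub, map_one, hx.2 σ hσ]) ha
  have hvc : L.v c ≤ 1 := by
    rw [hcc, map_div₀, map_pow, pow_one]; exact div_le_one_of_le₀ ha2 zero_le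
  have hac : x ^ p = 1 + (ζ - 1) ^ 1 * c := by rw [hcc]; field_simp; ring
  obtain ⟨k, hk1, hk2⟩ := exists_k hζ L.φ
  have hq := L.Q hζ hc hx hx1 L.vφ hk1 (by
      have := L.vφ (x - 1)
      rw [map_sub L.φ, map_one L.φ] at this
      rwa [this]) le_rfl hpf.out.one_lt hac hvc
  rw [pow_one, ← mul_sub, map_mul, nat_eq_one L.v L.hvp hk2, one_mul] at hq
  obtain ⟨j, hj⟩ := exists_int L.v L.hvp c hvc (tr _ (sy _ (L.hφ c hvc)) hq)
  have hζ₂0 : ζ₂ ≠ 0 := by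
    rintro rfl
    rw [zero_pow hpf.out.ne_zero] at h2
    exact hζ.ne_zero hpf.out.ne_zero h2.symm
  have hvζ₂ : L.v (ζ₂ ^ p) = 1 := by rw [h2]; exact L.v_zeta hζ
  have hvζ₂' : L.v ζ₂ = 1 := by
    rw [map_pow] at hvζ₂; exact (pow_eq_one_iff_of_nonneg zero_le hpf.out.ne_zero).1 hvζ₂
  have hζ₂1 : L.v (ζ₂ - 1) < 1 := by
    refine lt1_of_pow L.v (n := p) ?_
    have h3 := add_pow_p L.v L.hvp (ζ₂ - 1) 1 (sub_le _ hvζ₂'.le (by simp)) (by simp)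
    rw [sub_add_cancel, h2, one_pow] at h3
    have h4 := L.v.map_sub_lt hl h3
    have e : ζ - 1 - (ζ - ((ζ₂ - 1) ^ p + 1)) = (ζ₂ - 1) ^ p := by ring
    rwa [e] at h4
  obtain ⟨m, hm⟩ : ∃ m, m = j * (p - 1) := ⟨_, rfl⟩
  have hy : L.Ku ζ (x * ζ₂ ^ m) := by
    refine L.ku_of hζ (mul_ne_zero hx.1 (pow_ne_zero _ hζ₂0)) fun σ hσ => ?_
    obtain ⟨b, hb⟩ := L.ku_mul hζ hx hσ
    obtain ⟨d, hd⟩ := hp2 σ hσ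
    exact ⟨b + d * m, by rw [map_mul, map_pow, hb, hd]; ring⟩
  have hy1 : L.v (x * ζ₂ ^ m - 1) < 1 := by
    simpa using mulc L.v hx1 (powc L.v hζ₂1 (by simp) m) (by simp) (by simp)
  have hmj : (m : M) + j = j * p := by
    have : m + j = j * p := by
      rw [hm]
      obtain ⟨q, hq⟩ : ∃ q, p = q + 1 := ⟨p - 1, by have := hpf.out.pos; omega⟩
      rw [hq, add_tsub_cancel_right]; ring
    rw [← Nat.cast_add, this, Nat.cast_mul]
  have hcm : L.v (c + m) < 1 := by
    have : c + m = (c - j) + j * p := by rw [← hmj]; ring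
    rw [this]
    exact L.v.map_add_lt hj (mul_lt1 _ (v_nat_le _ _) L.hvp)
  have hst : L.v ((x * ζ₂ ^ m) ^ p - 1) ≤ L.v (ζ - 1) ^ (1 + 1) := by
    refine L.st_succ hζ hc hy ?_
    obtain ⟨r, hr, hr2⟩ := one_add_pow L.v (ζ - 1) hl.le m
    have e1 : (x * ζ₂ ^ m) ^ p = (1 + (ζ - 1) ^ 1 * c) * (1 + m * (ζ - 1) + (ζ - 1) ^ 2 * r) := by
      rw [mul_pow, hac, ← hr2, ← pow_mul, mul_comm m, pow_mul, h2]
      ring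
    have e2 : ((x * ζ₂ ^ m) ^ p - 1) / (ζ - 1) ^ 1 = (c + m) + (c * m + r + (ζ - 1) * c * r) * (ζ - 1) := by
      rw [e1]; field_simp; ring
    rw [e2]
    refine L.v.map_add_lt hcm (mul_lt1 _ ?_ hl)
    exact add_le _ (add_le _ (mul_le1 _ hvc (v_nat_le _ _)) hr) (mul_le1 _ (mul_le1 _ hl.le hvc) hr)
  have h3 := L.kummer3 hζ hc hodd hy hy1 p hpf.out.two_le le_rfl hst
  have h4 := L.kummer4 hζ hc hy hy1 h3
  intro σ hσ hs
  have h5 := h4 σ hσ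
  rw [map_mul, map_pow, hs] at h5
  exact mul_right_cancel₀ (pow_ne_zero _ hζ₂0) h5

lemma kummer1 (hodd : p ≠ 2) {ζ₂ : M} (h2 : ζ₂ ^ p = ζ) (hp2 : ∀ σ ∈ L.Gy (ζ - 1), ∃ b : ℕ, σ ζ₂ = ζ ^ b * ζ₂)
    {x : M} (hx : L.Ku ζ x) (hx1 : L.v x = 1) : 
    ∀ σ ∈ L.Gy (ζ - 1), σ ζ₂ = ζ₂ → σ x = x := by
  have hy : L.Ku ζ (x ^ (p ^ L.r - 1)) := by
    refine ⟨pow_ne_zero _ hx.1, fun σ hσ => ?_⟩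
    rw [← pow_mul, mul_comm, pow_mul, map_pow, hx.2 σ hσ]
  have h3 := L.kummer2 hζ hc hodd h2 hp2 hy (L.hr x hx1)
  intro σ hσ hs
  have h4 := h3 σ hσ hs
  obtain ⟨b, hb⟩ := L.ku_mul hζ hx hσ
  rw [map_pow, hb, mul_pow] at h4
  have h5 : (ζ ^ b) ^ (p ^ L.r - 1) = 1 := by
    have := pow_ne_zero (p ^ L.r - 1) hx.1
    exact mul_right_cancel₀ this (by rw [h4, one_mul])
  have h6 : ζ ^ b = 1 := by
    have h7 : (ζ ^ b) ^ (p ^ L.r) = 1 := by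
      rw [← pow_mul, mul_comm, pow_mul]
      obtain ⟨s, hs⟩ := Nat.exists_eq_succ_of_ne_zero L.hr0
      rw [hs, Nat.succ_eq_add_one, pow_succ', pow_mul, hζ.pow_eq_one, one_pow, one_pow]
    have : p ^ L.r = (p ^ L.r - 1) + 1 := by
      have := Nat.pow_pos (n := L.r) hpf.out.pos
      omega
    rw [this, pow_succ, h5, one_mul] at h7
    exact h7
  rw [hb, h6, one_mul]

theorem kummer (hodd : p ≠ 2) {ζ₂ : M} (h2 : ζ₂ ^ p = ζ)
    {x : M} (hx : L.Ku ζ x) : 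
    ∀ σ ∈ L.Gy (ζ - 1), σ ζ₂ = ζ₂ → σ x = x := by
  have hl0 := lam_ne hζ
  have hp2 : ∀ σ ∈ L.Gy (ζ - 1), ∃ b : ℕ, σ ζ₂ = ζ ^ b * ζ₂ := by
    intro σ hσ
    refine L.ku_mul hζ ⟨?_, fun σ hσ => ?_⟩ hσ
    · rintro rfl
      rw [zero_pow hpf.out.ne_zero] at h2
      exact hζ.ne_zero hpf.out.ne_zero h2.symm
    · rw [h2, ((L.mem_W hζ).1 hσ).2]
  obtain ⟨k, hk1, hk2⟩ := exists_gen_nat p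
  obtain ⟨δ, hδ, hδζ⟩ := L.kappa_surj hζ hc k hk1
  obtain ⟨m, hm⟩ := L.hW _ (L.Gy_le (ζ - 1)) (δ x / x ^ k) (div_ne_zero (by simpa using hx.1) (pow_ne_zero _ hx.1))
    (L.ku_fix hζ hc hx hδζ)
  obtain ⟨n, hn⟩ : ∃ n : ℤ, L.v x = exp n := by
    have : L.v x ≠ 0 := by simpa using hx.1
    exact ⟨_, (exp_log this).symm⟩
  obtain ⟨s, hs⟩ := (IsPGroup.iff_card).1 (L.isPGroup_W hζ hc)
  have hvl := (L.card_eq hζ hc).2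
  rw [hs] at hm hvl
  rw [map_div₀, map_pow, L.vI δ hδ, hn, ← exp_nsmul, ← exp_sub, exp_inj] at hm
  have hd : ((p ^ s : ℕ) : ℤ) ∣ n := by
    have h1 : ((p ^ s : ℕ) : ℤ) ∣ ((k : ℤ) - 1) * n := ⟨-m, by simp at hm; push_cast; linear_combination -hm⟩
    refine IsCoprime.dvd_of_dvd_mul_left ?_ h1
    push_cast
    refine IsCoprime.pow_left ?_
    rw [Prime.coprime_iff_not_dvd (Nat.prime_iff_prime_int.1 hpf.out)]
    have := hk2 1 one_pos (by have := hpf.out.two_le; omega)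
    rwa [pow_one] at this
  obtain ⟨t, rfl⟩ := hd
  have hy : L.Ku ζ (x * (ζ - 1) ^ t) := by
    refine ⟨mul_ne_zero hx.1 (zpow_ne_zero _ hl0), fun σ hσ => ?_⟩
    rw [mul_pow, map_mul, hx.2 σ hσ, map_pow, map_zpow₀, L.lam_fix hζ hσ]
  have hvy : L.v (x * (ζ - 1) ^ t) = 1 := by
    rw [map_mul, map_zpow₀, hn, hvl, ← exp_zsmul, ← exp_add, ← exp_zero]
    congr 1
    simp only [smul_eq_mul]; ring
  intro σ hσ h
  have h5 := L.kummer1 hζ hc hodd h2 hp2 hy hvy σ hσ h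
  rw [map_mul, map_zpow₀, L.lam_fix hζ hσ] at h5
  exact mul_right_cancel₀ (zpow_ne_zero _ hl0) h5
end LD

end

section
open WithZero
set_option linter.unusedSectionVars false

lemma char_sep {G M : Type*} [CommGroup G] [Finite G] [Field M] {p : ℕ} [hpf : Fact p.Prime] {ζ : M}
    (hζ : IsPrimitiveRoot ζ p) (g : G) (h : ∀ χ : G →* Mˣ, (∀ x, χ x ^ p = 1) → χ g = 1) :
    ∃ h : G, h ^ p = g := by
  by_contra hg
  let P : Subgroup G := (powMonoidHom p : G →* G).range
  have hgP : g ∉ P := by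
    rintro ⟨h, hh⟩
    exact hg ⟨h, hh⟩
  have hne : (QuotientGroup.mk g : G ⧸ P) ≠ 1 := by
    rwa [Ne, QuotientGroup.eq_one_iff]
  have hexp : ∀ x : G ⧸ P, x ^ p = 1 := by
    intro x
    obtain ⟨y, rfl⟩ := QuotientGroup.mk_surjective x
    rw [← QuotientGroup.mk_pow, QuotientGroup.eq_one_iff]
    exact ⟨y, rfl⟩
  have hd : Monoid.exponent (G ⧸ P) ∣ p := Monoid.exponent_dvd_of_forall_pow_eq_one hexp
  haveI : NeZero p := ⟨hpf.out.ne_zero⟩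
  haveI : HasEnoughRootsOfUnity M p := ⟨⟨ζ, hζ⟩, rootsOfUnity.isCyclic M p⟩
  haveI := HasEnoughRootsOfUnity.of_dvd M hd
  obtain ⟨χ, hχ⟩ := CommGroup.exists_apply_ne_one_of_hasEnoughRootsOfUnity (G ⧸ P) M hne
  exact hχ (h (χ.comp (QuotientGroup.mk' P)) fun x => by
    rw [← map_pow, MonoidHom.comp_apply, map_pow, hexp, map_one])

lemma cyc_of {G M : Type*} [CommGroup G] [Finite G] [Field M] {p : ℕ} [hpf : Fact p.Prime] {ζ : M}
    (hζ : IsPrimitiveRoot ζ p) (hG : IsPGroup p G) (ψ : G →* Mˣ) (hψ : ∀ x, ψ x ^ p = 1)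
    (h : ∀ χ : G →* Mˣ, (∀ x, χ x ^ p = 1) → ∀ g, ψ g = 1 → χ g = 1) :
    ∃ w : G, ∀ g, g ∈ Subgroup.zpowers w := by
  have hP : ∀ g, ψ g = 1 → ∃ h : G, h ^ p = g := fun g hg => char_sep hζ g fun χ hχ => h χ hχ g hg
  obtain ⟨w, hw⟩ : ∃ w : G, ∀ g, ∃ a : ℕ, ψ g = ψ w ^ a := by
    by_cases hall : ∀ g, ψ g = 1
    · exact ⟨1, fun g => ⟨0, by simpa using hall g⟩⟩
    · push Not at hall
      obtain ⟨w, hw⟩ := hall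
      refine ⟨w, fun g => ?_⟩
      have : orderOf (ψ w) = p := orderOf_eq_prime (hψ w) hw
      have hpr : IsPrimitiveRoot (ψ w) p := this ▸ IsPrimitiveRoot.orderOf _
      haveI : NeZero p := ⟨hpf.out.ne_zero⟩
      have hpr' : IsPrimitiveRoot ((ψ w : Mˣ) : M) p := hpr.map_of_injective (f := Units.coeHom M) Units.val_injective
      have hg : ((ψ g : Mˣ) : M) ^ p = 1 := by rw [← Units.val_pow_eq_pow_val, hψ, Units.val_one]
      obtain ⟨i, -, hi⟩ := hpr'.eq_pow_of_pow_eq_one hg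
      exact ⟨i, by ext; push_cast; exact hi.symm⟩
  refine ⟨w, ?_⟩
  have key : ∀ n : ℕ, ∀ g, ∃ h : G, ∃ c ∈ Subgroup.zpowers w, g = c * h ^ (p ^ n) := by
    intro n
    induction n with
    | zero => intro g; exact ⟨g, 1, one_mem _, by simp⟩
    | succ n ih =>
      intro g
      obtain ⟨h, c, hc, rfl⟩ := ih g
      obtain ⟨a, ha⟩ := hw h
      obtain ⟨k, hk⟩ := hP ((w ^ a)⁻¹ * h) (by rw [map_mul, map_inv, map_pow, ha, inv_mul_cancel])
      refine ⟨k, c * (w ^ a) ^ (p ^ n), mul_mem hc (pow_mem (pow_mem (Subgroup.mem_zpowers w) _) _), ?_⟩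
      rw [pow_succ', pow_mul, hk, mul_pow]
      group
  obtain ⟨s, hs⟩ := IsPGroup.iff_card.1 hG
  intro g
  obtain ⟨h, c, hc, rfl⟩ := key s g
  rw [← hs, pow_card_eq_one', mul_one]; exact hc

namespace LD
open VL
variable {M : Type*} [Field M] [Algebra ℚ M] [FiniteDimensional ℚ M] {p : ℕ} [hpf : Fact p.Prime]
  (L : LD M p) {ζ : M} (hζ : IsPrimitiveRoot ζ p) (hc : ∀ a b : M ≃ₐ[ℚ] M, a * b = b * a)

/-- resolvent -/
lemma resolvent (W : Subgroup (M ≃ₐ[ℚ] M)) (χ : W →* Mˣ) (hχ : ∀ σ τ : W, (σ : M ≃ₐ[ℚ] M) (χ τ : M) = χ τ) :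
    ∃ x : M, x ≠ 0 ∧ ∀ σ : W, (σ : M ≃ₐ[ℚ] M) x = χ σ * x := by
  classical
  haveI : Fintype W := Fintype.ofFinite W
  have hli := linearIndependent_monoidHom M M
  let f : W → (M →* M) := fun σ => ((σ : M ≃ₐ[ℚ] M) : M →* M)
  have hf : Function.Injective f := by
    intro a b hab
    ext x
    exact DFunLike.congr_fun hab x
  have hli2 := hli.comp f hf
  rw [Fintype.linearIndependent_iff] at hli2
  have : ¬ (∑ σ : W, ((χ σ⁻¹ : Mˣ) : M) • ((f σ : M → M)) = 0) := by
    intro h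
    have := hli2 (fun σ => ((χ σ⁻¹ : Mˣ) : M)) h 1
    simp at this
  obtain ⟨y, hy⟩ := Function.ne_iff.1 this
  refine ⟨_, hy, fun σ => ?_⟩
  simp only [Finset.sum_apply, Pi.smul_apply, smul_eq_mul, map_sum, map_mul, Finset.mul_sum]
  refine Fintype.sum_equiv (Equiv.mulLeft σ) _ _ fun τ => ?_
  rw [hχ]
  simp only [Equiv.coe_mulLeft, mul_inv_rev, map_mul, Units.val_mul]
  rw [show ((χ σ : Mˣ) : M) * (((χ τ⁻¹ : Mˣ) : M) * ((χ σ⁻¹ : Mˣ) : M) * (f (σ * τ)) y) =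
    ((χ σ * χ σ⁻¹ : Mˣ) : M) * ((χ τ⁻¹ : Mˣ) : M) * (f (σ * τ)) y by push_cast; ring]
  rw [← map_mul, mul_inv_cancel, map_one]
  simp [f]

include hζ hc
theorem W_cyc (hodd : p ≠ 2) {ζ₂ : M} (h2 : ζ₂ ^ p = ζ) :
    ∃ w ∈ L.Gy (ζ - 1), ∀ σ ∈ L.Gy (ζ - 1), ∃ a : ℤ, w ^ a = σ := by
  letI : CommGroup (L.Gy (ζ - 1)) := { (inferInstance : Group (L.Gy (ζ - 1))) with
    mul_comm := fun a b => Subtype.ext (hc a b) }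
  have hζ₂0 : ζ₂ ≠ 0 := by
    rintro rfl
    rw [zero_pow hpf.out.ne_zero] at h2
    exact hζ.ne_zero hpf.out.ne_zero h2.symm
  have hku : L.Ku ζ ζ₂ := ⟨hζ₂0, fun σ hσ => by rw [h2, ((L.mem_W hζ).1 hσ).2]⟩
  have hfix : ∀ σ ∈ L.Gy (ζ - 1), ∀ b : ℕ, σ (ζ ^ b) = ζ ^ b := fun σ hσ b => by
    rw [map_pow, ((L.mem_W hζ).1 hσ).2]
  have hq : ∀ σ ∈ L.Gy (ζ - 1), ∃ b : ℕ, σ ζ₂ / ζ₂ = ζ ^ b := fun σ hσ => by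
    obtain ⟨b, hb⟩ := L.ku_mul hζ hku hσ
    exact ⟨b, by rw [hb]; field_simp⟩
  let ψ : L.Gy (ζ - 1) →* Mˣ := 
    { toFun := fun σ => Units.mk0 ((σ : M ≃ₐ[ℚ] M) ζ₂ / ζ₂) (div_ne_zero (by simpa using hζ₂0) hζ₂0)
      map_one' := by ext; simp [hζ₂0]
      map_mul' := fun σ τ => by
        ext
        obtain ⟨b, hb⟩ := hq τ τ.2
        have h1 : (τ : M ≃ₐ[ℚ] M) ζ₂ = ζ ^ b * ζ₂ := by rw [← hb]; field_simp
        have h3 := hfix σ σ.2 b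
        simp only [Units.val_mk0, Units.val_mul, Subgroup.coe_mul, AlgEquiv.mul_apply]
        rw [h1, map_mul, h3]
        field_simp }
  have hψ : ∀ x, ψ x ^ p = 1 := by
    intro σ
    ext
    obtain ⟨b, hb⟩ := hq σ σ.2
    simp only [ψ, MonoidHom.coe_mk, OneHom.coe_mk, Units.val_pow_eq_pow_val, Units.val_mk0, Units.val_one]
    rw [hb, ← pow_mul, mul_comm, pow_mul, hζ.pow_eq_one, one_pow]
  obtain ⟨w, hw⟩ := cyc_of hζ (L.isPGroup_W hζ hc) ψ hψ (by
    intro χ hχ g hg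
    have hχz : ∀ τ, ∃ b : ℕ, ((χ τ : Mˣ) : M) = ζ ^ b := fun τ => by
      obtain ⟨b, -, hb⟩ := hζ.eq_pow_of_pow_eq_one (show ((χ τ : Mˣ) : M) ^ p = 1 by
        rw [← Units.val_pow_eq_pow_val, hχ, Units.val_one])
      exact ⟨b, hb.symm⟩
    obtain ⟨x, hx0, hx⟩ := resolvent (L.Gy (ζ - 1)) χ (fun σ τ => by
      obtain ⟨b, hb⟩ := hχz τ
      rw [hb, hfix σ σ.2])
    have hk : L.Ku ζ x := L.ku_of hζ hx0 (fun σ hσ => by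
      obtain ⟨b, hb⟩ := hχz ⟨σ, hσ⟩
      exact ⟨b, by rw [← hb]; exact hx ⟨σ, hσ⟩⟩)
    have hg' : (g : M ≃ₐ[ℚ] M) ζ₂ = ζ₂ := by
      have := congrArg Units.val hg
      simp only [ψ, MonoidHom.coe_mk, OneHom.coe_mk, Units.val_mk0, Units.val_one] at this
      rwa [div_eq_one_iff_eq hζ₂0] at this
    have h3 := L.kummer hζ hc hodd h2 hk g g.2 hg'
    rw [hx g] at h3
    ext
    rw [Units.val_one]
    exact mul_right_cancel₀ hx0 (by rw [h3, one_mul]))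
  refine ⟨w, w.2, fun σ hσ => ?_⟩
  obtain ⟨a, ha⟩ := Subgroup.mem_zpowers_iff.1 (hw ⟨σ, hσ⟩)
  exact ⟨a, by simpa using congrArg Subtype.val ha⟩

theorem card_I_odd (hodd : p ≠ 2) {ζ₂ : M} (h2 : ζ₂ ^ p = ζ) (s : ℕ)
    (hs : ∀ σ ∈ L.I, σ ζ = ζ → σ ^ (p ^ s) = 1) : Nat.card L.I ≤ (p - 1) * p ^ s := by
  rw [(L.card_eq hζ hc).1]
  refine Nat.mul_le_mul_left _ ?_
  obtain ⟨w, hw, h⟩ := L.W_cyc hζ hc hodd h2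
  have hle : L.Gy (ζ - 1) ≤ Subgroup.zpowers w := fun σ hσ => by
    obtain ⟨a, ha⟩ := h σ hσ
    exact Subgroup.mem_zpowers_iff.2 ⟨a, ha⟩
  obtain ⟨h3, h4⟩ := (L.mem_W hζ).1 hw
  calc Nat.card (L.Gy (ζ - 1)) ≤ Nat.card (Subgroup.zpowers w) := Subgroup.card_le_of_le hle
    _ = orderOf w := Nat.card_zpowers w
    _ ≤ p ^ s := orderOf_le_of_pow_eq_one (Nat.pow_pos hpf.out.pos) (hs w h3 h4)
end LD

end

section
open IsDedekindDomain WithZero NumberField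
set_option linter.unusedSectionVars false
set_option linter.style.haveILetI false

section
variable {M : Type*} [Field M] [NumberField M] [IsGalois ℚ M]

lemma gen_top (hc : ∀ a b : M ≃ₐ[ℚ] M, a * b = b * a) (G : Subgroup (M ≃ₐ[ℚ] M))
    (h : ∀ p : ℕ, p.Prime → ∃ (P : HeightOneSpectrum (𝓞 M)) (L : LD M p), L.v = P.valuation M ∧ L.I ≤ G) :
    G = ⊤ := by
  by_contra hG
  haveI : G.Normal := ⟨fun n hn g => by rwa [hc g n, mul_assoc, mul_inv_cancel, mul_one]⟩
  let F := IntermediateField.fixedField G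
  haveI : IsGalois ℚ F := IsGalois.of_fixedField_normal_subgroup G
  have hF : 1 < Module.finrank ℚ F := by
    have h1 : Module.finrank ℚ F ≠ 1 := by
      intro h1
      have hb : F = ⊥ := IntermediateField.finrank_eq_one_iff.1 h1
      apply hG
      rw [← IntermediateField.fixingSubgroup_fixedField G]
      change F.fixingSubgroup = ⊤
      rw [hb, IntermediateField.fixingSubgroup_bot]
    have : 0 < Module.finrank ℚ F := Module.finrank_pos
    omega
  obtain ⟨p, hp, hr⟩ := NumberField.exists_not_isUnramifiedAt_int_of_isGalois (K := F) (𝒪 := 𝓞 F) hF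
  haveI : Fact p.Prime := ⟨hp⟩
  obtain ⟨P, L, hv, hI⟩ := h p hp
  have hmem : ∀ x : 𝓞 F, x ∈ P.asIdeal.under (𝓞 F) ↔ L.v ((x : F) : M) < 1 := by
    intro x
    rw [Ideal.mem_comap, hv, ← HeightOneSpectrum.valuation_lt_one_iff_mem (K := M)]
    rfl
  have hval : ∀ x : 𝓞 F, x ∈ P.asIdeal.under (𝓞 F) → L.v ((x : F) : M) ≤ exp (-(Nat.card L.I : ℤ)) := by
    intro x hx
    rw [hmem] at hx
    by_cases h0 : ((x : F) : M) = 0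
    · rw [h0, map_zero]; exact zero_le
    obtain ⟨k, hk⟩ := L.hW L.I le_rfl _ h0 (fun σ hσ => by
      have := (x : F).2
      rw [IntermediateField.mem_fixedField_iff] at this
      exact this σ (hI hσ))
    rw [hk, ← exp_zero, exp_lt_exp] at hx
    rw [hk, exp_le_exp]
    have : (0 : ℤ) < (Nat.card L.I : ℤ) := by exact_mod_cast Nat.card_pos
    nlinarith [neg_of_mul_neg_right hx this.le]
  have hpr : (P.asIdeal.under (𝓞 F)).IsPrime := P.isPrime.under _
  have hpQ : (p : 𝓞 F) ∈ P.asIdeal.under (𝓞 F) := by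
    rw [hmem]
    simpa using L.hvp
  refine hr (P.asIdeal.under (𝓞 F)) hpr hpQ ?_
  rw [← Ideal.ramificationIdx_eq_one_iff]
  have hspan : (P.asIdeal.under (𝓞 F)).LiesOver (Ideal.span {(p : ℤ)}) :=
    (Ideal.liesOver_span_iff Ideal.IsPrime.ne_top' (Nat.prime_iff_prime_int.1 hp)).2 (by simpa using hpQ)
  rw [← Ideal.ramificationIdx'_eq_ramificationIdx (Ideal.span {(p : ℤ)}) _ (by simpa using hp.ne_zero)]
  rw [Ideal.ramificationIdx'_spec]
  · rw [Ideal.map_span, Set.image_singleton, Ideal.span_singleton_le_iff_mem, pow_one]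
    simpa using hpQ
  · rw [Ideal.map_span, Set.image_singleton, Ideal.span_singleton_le_iff_mem]
    intro hin
    have key : ∀ y ∈ (P.asIdeal.under (𝓞 F)) ^ (1 + 1), L.v ((y : F) : M) ≤ exp (-(Nat.card L.I : ℤ)) * exp (-(Nat.card L.I : ℤ)) := by
      intro y hy
      rw [pow_two] at hy
      refine Submodule.mul_induction_on hy ?_ ?_
      · intro a ha b hb
        have : (((a * b : 𝓞 F) : F) : M) = ((a : F) : M) * ((b : F) : M) := rfl
        rw [this, map_mul]
        exact mul_le_mul' (hval a ha) (hval b hb)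
      · intro a b ha hb
        have : (((a + b : 𝓞 F) : F) : M) = ((a : F) : M) + ((b : F) : M) := rfl
        rw [this]
        exact VL.add_le _ ha hb
    have h2 := key _ hin
    have h3 : ((((algebraMap ℤ (𝓞 F)) (p : ℤ) : 𝓞 F) : F) : M) = (p : M) := by simp
    rw [h3, L.hp, ← exp_add, exp_le_exp] at h2
    have : (0 : ℤ) < (Nat.card L.I : ℤ) := by exact_mod_cast Nat.card_pos
    omega
end

end

section
set_option linter.style.haveILetI false

lemma card_sup_le {A : Type*} [CommGroup A] [Finite A] (H K : Subgroup A) :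
    Nat.card (H ⊔ K : Subgroup A) ≤ Nat.card H * Nat.card K := by
  rw [← Nat.card_prod]
  refine Nat.card_le_card_of_surjective
    (fun x : H × K => (⟨x.1 * x.2, mul_mem ((le_sup_left : H ≤ H ⊔ K) x.1.2) ((le_sup_right : K ≤ H ⊔ K) x.2.2)⟩ : (H ⊔ K : Subgroup A))) ?_
  rintro ⟨x, hx⟩
  obtain ⟨y, hy, z, hz, rfl⟩ := Subgroup.mem_sup.1 hx
  exact ⟨(⟨y, hy⟩, ⟨z, hz⟩), rfl⟩

lemma card_iSup_le {A : Type*} [CommGroup A] [Finite A] (I : ℕ → Subgroup A) (T : Finset ℕ) :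
    Nat.card (T.sup I : Subgroup A) ≤ ∏ q ∈ T, Nat.card (I q) := by
  classical
  induction T using Finset.induction_on with
  | empty => simp
  | insert a s ha ih =>
    rw [Finset.sup_insert, Finset.prod_insert ha]
    exact (card_sup_le _ _).trans (Nat.mul_le_mul_left _ ih)

lemma card_global {A M : Type*} [CommGroup A] [Finite A] [Field M] [CharZero M]
    (I : ℕ → Subgroup A) (c : A) (hc : c * c = 1) (T : Finset ℕ) (hgen : I 2 ⊔ T.sup I = ⊤)
    (b : ℕ → ℕ) (hb : ∀ q ∈ T, Nat.card (I q) ≤ b q) (s : ℕ) (hs : ∀ σ ∈ I 2, σ ^ (2 ^ s) = 1)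
    (ψ : A →* Mˣ) (hψ : ∀ x, ψ x ^ 2 = 1) (hψc : ψ c = 1) (hψI : ∀ q ∈ T, ∀ σ ∈ I q, ψ σ = 1)
    (hχ : ∀ χ : A →* Mˣ, (∀ x, χ x ^ 2 = 1) → χ c = 1 → (∀ q ∈ T, ∀ σ ∈ I q, χ σ = 1) →
      ∀ σ, ψ σ = 1 → χ σ = 1) :
    Nat.card A ≤ 2 ^ s * ((∏ q ∈ T, b q) * 2) := by
  classical
  haveI : Fact (Nat.Prime 2) := ⟨Nat.prime_two⟩
  let N : Subgroup A := T.sup I ⊔ Subgroup.zpowers c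
  have hTN : ∀ q ∈ T, I q ≤ N := fun q hq => (Finset.le_sup (f := I) hq).trans le_sup_left
  have hcN : c ∈ N := (le_sup_right : _ ≤ N) (Subgroup.mem_zpowers c)
  have hlift : ∀ g : A, ∃ h ∈ I 2, (QuotientGroup.mk g : A ⧸ N) = QuotientGroup.mk h := by
    intro g
    have : g ∈ I 2 ⊔ T.sup I := hgen ▸ Subgroup.mem_top g
    obtain ⟨y, hy, z, hz, rfl⟩ := Subgroup.mem_sup.1 this
    refine ⟨y, hy, ?_⟩
    rw [eq_comm, QuotientGroup.eq, inv_mul_cancel_left]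
    exact (le_sup_left : _ ≤ N) hz
  have hpow : ∀ g : A ⧸ N, g ^ (2 ^ s) = 1 := by
    intro g
    obtain ⟨g, rfl⟩ := QuotientGroup.mk_surjective g
    obtain ⟨h, hh, e⟩ := hlift g
    rw [e, ← QuotientGroup.mk_pow, hs h hh, QuotientGroup.mk_one]
  have hker : N ≤ ψ.ker := by
    refine sup_le (Finset.sup_le fun q hq σ hσ => hψI q hq σ hσ) ?_
    rw [Subgroup.zpowers_le]; exact hψc
  obtain ⟨w, hw⟩ := cyc_of (G := A ⧸ N) (M := M) (p := 2) (ζ := -1) (IsPrimitiveRoot.neg_one 0 (by decide))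
    (fun g => ⟨s, hpow g⟩) (QuotientGroup.lift N ψ hker) (by
      intro x
      obtain ⟨x, rfl⟩ := QuotientGroup.mk_surjective x
      exact hψ x) (by
      intro χ h2 g hg
      obtain ⟨g, rfl⟩ := QuotientGroup.mk_surjective g
      have := hχ (χ.comp (QuotientGroup.mk' N)) (fun x => h2 _) (by
        have : (QuotientGroup.mk' N) c = 1 := (QuotientGroup.eq_one_iff c).2 hcN
        rw [MonoidHom.comp_apply, this, map_one]) (fun q hq σ hσ => by
        have : (QuotientGroup.mk' N) σ = 1 := (QuotientGroup.eq_one_iff σ).2 (hTN q hq hσ)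
        rw [MonoidHom.comp_apply, this, map_one]) g hg
      exact this)
  have h1 : Nat.card (A ⧸ N) ≤ 2 ^ s := by
    rw [← orderOf_eq_card_of_forall_mem_zpowers hw]
    exact orderOf_le_of_pow_eq_one (by positivity) (hpow w)
  have h2 : Nat.card N ≤ (∏ q ∈ T, b q) * 2 := by
    refine (card_sup_le _ _).trans (Nat.mul_le_mul ?_ ?_)
    · exact (card_iSup_le I T).trans (Finset.prod_le_prod' hb)
    · rw [Nat.card_zpowers]
      exact orderOf_le_of_pow_eq_one two_pos (by rw [pow_two, hc])
  rw [Subgroup.card_eq_card_quotient_mul_card_subgroup N]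
  exact Nat.mul_le_mul h1 h2

end

section
open IsDedekindDomain WithZero NumberField
set_option linter.unusedSectionVars false
set_option linter.style.haveILetI false

lemma exists_LD' (M : Type*) [Field M] [NumberField M] [IsGalois ℚ M] (p : ℕ) (hp : p.Prime) :
    ∃ (P : HeightOneSpectrum (𝓞 M)) (L : LD M p), L.v = P.valuation M := by
  have hpp : Prime (p : ℤ) := Nat.prime_iff_prime_int.1 hp
  have hmax : (Ideal.span {(p : ℤ)}).IsMaximal := 
      ((Ideal.span_singleton_prime hpp.ne_zero).2 hpp).isMaximal (by simpa using hp.ne_zero)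
  obtain ⟨Q, hQ, hQ2⟩ := Ideal.exists_maximal_ideal_liesOver_of_isIntegral (S := 𝓞 M) (Ideal.span {(p : ℤ)})
  have hpQ : (p : 𝓞 M) ∈ Q := by
    have : (p : ℤ) ∈ Q.under ℤ := by
      rw [← hQ2.over]; exact Ideal.mem_span_singleton_self _
    simpa using this
  have hne : Q ≠ ⊥ := by
    rintro rfl
    rw [Ideal.mem_bot] at hpQ
    exact hp.ne_zero (by exact_mod_cast hpQ)
  obtain ⟨L, h, -⟩ := exists_LD (⟨Q, hQ.isPrime, hne⟩ : HeightOneSpectrum (𝓞 M)) p hp hpQ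
  exact ⟨_, L, h⟩

lemma v_integral {M : Type*} [Field M] (v : Valuation M ℤᵐ⁰) {x : M} (hx : IsIntegral ℤ x) :
    v x ≤ 1 := by
  by_contra h
  rw [not_le] at h
  obtain ⟨f, hf, hx⟩ := hx
  have hlt : ∀ i ∈ Finset.range f.natDegree, v ((f.coeff i : M) * x ^ i) < v (x ^ f.natDegree) := by
    intro i hi
    rw [Finset.mem_range] at hi
    rw [map_mul, map_pow, map_pow]
    exact (mul_le_of_le_one_left' (VL.v_int_le v _)).trans_lt (pow_lt_pow_right₀ h hi)
  have h0 : (0 : ℤᵐ⁰) < v (x ^ f.natDegree) := by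
    rw [map_pow]; exact pow_pos (zero_lt_one.trans h) _
  have h2 := v.map_sum_lt h0.ne' hlt
  rw [Polynomial.eval₂_eq_sum_range, Finset.sum_range_succ, hf.coeff_natDegree, map_one, one_mul] at hx
  have : v (x ^ f.natDegree) = v (∑ i ∈ Finset.range f.natDegree, (f.coeff i : M) * x ^ i) := by
    rw [← Valuation.map_neg]
    congr 1
    have e := eq_neg_of_add_eq_zero_right hx
    rw [e, neg_neg]; rfl
  rw [this] at h2
  exact lt_irrefl _ h2

namespace LD
open VL
variable {M : Type*} [Field M] [Algebra ℚ M] [FiniteDimensional ℚ M] {p : ℕ} [hpf : Fact p.Prime]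
  (L : LD M p)

lemma fix_root {σ : M ≃ₐ[ℚ] M} (hσ : σ ∈ L.I) {η : M} {m : ℕ} (hm : ¬ p ∣ m) (h : η ^ m = 1) : σ η = η := by
  have hm0 : m ≠ 0 := by rintro rfl; simp at hm
  have hη0 : η ≠ 0 := by rintro rfl; simp [hm0] at h
  have hv : L.v η = 1 := by
    have : L.v η ^ m = 1 := by rw [← map_pow, h, map_one]
    exact (pow_eq_one_iff_of_nonneg zero_le hm0).1 this
  have h1 := L.unit_div hσ hv
  have hw : (σ η / η) ^ m = 1 := by rw [div_pow, ← map_pow, h, map_one, div_one]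
  by_contra hne
  have hne' : σ η / η - 1 ≠ 0 := by
    rw [sub_ne_zero, Ne, div_eq_one_iff_eq hη0]; exact hne
  have hs : ∑ i ∈ Finset.range m, (σ η / η) ^ i = 0 := by
    have := mul_geom_sum (σ η / η) m
    rw [hw, sub_self] at this
    exact (mul_eq_zero.1 this).resolve_left hne'
  have h3 : L.v (∑ i ∈ Finset.range m, ((σ η / η) ^ i - 1)) < 1 := by
    refine L.v.map_sum_lt one_ne_zero fun i _ => ?_
    simpa using powc L.v h1 (by simp) i
  rw [Finset.sum_sub_distrib, hs] at h3
  simp only [Finset.sum_const, Finset.card_range, nsmul_eq_mul, mul_one, zero_sub] at h3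
  rw [Valuation.map_neg, nat_lt_iff L.v L.hvp] at h3
  exact hm h3

lemma fix_alpha {σ : M ≃ₐ[ℚ] M} (hσ : σ ∈ L.I) {α : M} {N : ℕ} (hN : ¬ p ∣ N) (hα : IsIntegral ℤ α)
    (h : σ α ≠ α → ∃ γ, IsIntegral ℤ γ ∧ (σ α - α) * γ = N) : σ α = α := by
  by_contra hne
  obtain ⟨γ, hγ, e⟩ := h hne
  have h1 := L.hI σ hσ α (v_integral _ hα)
  have h2 := mul_lt1 L.v (v_integral L.v hγ) h1
  rw [mul_comm, e, nat_lt_iff L.v L.hvp] at h2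
  exact hN h2

end LD

lemma pow_apply_root {M : Type*} [Field M] [Algebra ℚ M] (σ : M ≃ₐ[ℚ] M) {ζ : M} {u : ℕ} (h : σ ζ = ζ ^ u) (k : ℕ) :
    (σ ^ k) ζ = ζ ^ (u ^ k) := by
  induction k with
  | zero => simp
  | succ k ih => rw [pow_succ', AlgEquiv.mul_apply, ih, map_pow, h, ← pow_mul, pow_succ']

lemma fix_pow_alpha {M : Type*} [Field M] [Algebra ℚ M] (σ : M ≃ₐ[ℚ] M) {α : M} {p d j t : ℕ} (hp : p.Prime) (hd : 0 < d)
    (h1 : σ ^ (p ^ j) = 1) (h2 : (σ ^ d) α = α) (ht : d ≤ t) : (σ ^ (p ^ t)) α = α := by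
  have key : ∀ a : ℕ, (σ ^ a) α = α ↔ a ∈ {a | (σ ^ a) α = α} := fun a => Iff.rfl
  let S := MulAction.stabilizer (M ≃ₐ[ℚ] M) α
  have hS : ∀ τ : M ≃ₐ[ℚ] M, τ ∈ S ↔ τ α = α := fun τ => Iff.rfl
  rw [← hS] at h2 ⊢
  have h1' : σ ^ (p ^ j) ∈ S := h1 ▸ one_mem S
  have hg : σ ^ (Nat.gcd (p ^ j) d) ∈ S := by
    rw [← zpow_natCast, Nat.gcd_eq_gcd_ab, zpow_add, zpow_mul, zpow_mul, zpow_natCast, zpow_natCast]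
    exact mul_mem (zpow_mem h1' _) (zpow_mem h2 _)
  obtain ⟨i, -, hi⟩ := (Nat.dvd_prime_pow hp).1 (Nat.gcd_dvd_left (p ^ j) d)
  have hle : p ^ i ≤ d := hi ▸ Nat.le_of_dvd hd (Nat.gcd_dvd_right (p ^ j) d)
  have hit : i ≤ t := by
    have := Nat.lt_pow_self (n := i) hp.one_lt
    omega
  obtain ⟨k, rfl⟩ := Nat.exists_eq_add_of_le hit
  rw [pow_add, pow_mul, ← hi]
  exact pow_mem hg _

end

section
set_option linter.unusedSectionVars false
set_option linter.style.haveILetI false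

lemma two_pow_dvd (u : ℤ) (hu : ¬ (2 : ℤ) ∣ u) (k : ℕ) : (2 : ℤ) ^ (k + 3) ∣ u ^ (2 ^ (k + 1)) - 1 := by
  induction k with
  | zero =>
    have h : Odd u := by rwa [← Int.not_even_iff_odd, even_iff_two_dvd]
    have := Int.eight_dvd_sq_sub_one_of_odd h
    norm_num
    exact this
  | succ k ih =>
    have e : u ^ (2 ^ (k + 1 + 1)) - 1 = (u ^ (2 ^ (k + 1)) - 1) * (u ^ (2 ^ (k + 1)) + 1) := by
      rw [pow_succ 2 (k + 1), pow_mul]; ring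
    rw [e, show k + 1 + 3 = (k + 3) + 1 by ring, pow_succ]
    refine mul_dvd_mul ih ?_
    have h : Odd u := by rwa [← Int.not_even_iff_odd, even_iff_two_dvd]
    exact even_iff_two_dvd.1 ((h.pow).add_odd odd_one)

lemma prim_pow_eq {M : Type*} [Field M] {ζ : M} {n : ℕ} (hζ : IsPrimitiveRoot ζ n) (hn : 0 < n) (a b : ℕ) :
    ζ ^ a = ζ ^ b ↔ (n : ℤ) ∣ (a : ℤ) - b := by
  have : ζ ^ a = ζ ^ b ↔ b ≡ a [MOD n] := by
    rw [hζ.eq_orderOf, eq_comm]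
    have hu := hζ.isUnit hn.ne'
    obtain ⟨z, rfl⟩ := hu
    rw [orderOf_units, ← pow_eq_pow_iff_modEq]
    norm_cast
  rw [this, Nat.modEq_iff_dvd]

namespace LD
open VL
variable {M : Type*} [Field M] [Algebra ℚ M] [FiniteDimensional ℚ M] {p : ℕ} [hpf : Fact p.Prime]
  (L : LD M p)

lemma zeta_u {σ : M ≃ₐ[ℚ] M} (hσ : σ ∈ L.I) {ζ : M} {n e m : ℕ} (hζ : IsPrimitiveRoot ζ n) (hn : 0 < n) (hnm : n = p ^ e * m)
    (hm : ¬ p ∣ m) : ∃ u : ℕ, σ ζ = ζ ^ u ∧ (m : ℤ) ∣ (u : ℤ) - 1 := by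
  haveI : NeZero n := ⟨hn.ne'⟩
  obtain ⟨u, -, hu⟩ := hζ.eq_pow_of_pow_eq_one (show (σ ζ) ^ n = 1 by rw [← map_pow, hζ.pow_eq_one, map_one])
  refine ⟨u, hu.symm, ?_⟩
  have h1 := L.fix_root hσ hm (η := ζ ^ (p ^ e)) (by rw [← pow_mul, ← hnm, hζ.pow_eq_one])
  rw [map_pow, ← hu, ← pow_mul, prim_pow_eq hζ hn, hnm] at h1
  push_cast at h1
  have h2 : (p : ℤ) ^ e * m ∣ (p : ℤ) ^ e * ((u : ℤ) - 1) := by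
    convert h1 using 1; ring
  exact (mul_dvd_mul_iff_left (pow_ne_zero _ (by exact_mod_cast hpf.out.ne_zero))).1 h2

lemma glue {σ : M ≃ₐ[ℚ] M} {ζ : M} {n e m u k : ℕ} (hζ : IsPrimitiveRoot ζ n) (hn : 0 < n) (hnm : n = p ^ e * m)
    (hm : ¬ p ∣ m) (hu : σ ζ = ζ ^ u) (h1 : (m : ℤ) ∣ (u : ℤ) - 1) (h2 : (p : ℤ) ^ e ∣ (u : ℤ) ^ k - 1) :
    (σ ^ k) ζ = ζ := by
  rw [pow_apply_root σ hu]
  conv_rhs => rw [← pow_one ζ]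
  rw [prim_pow_eq hζ hn, hnm]
  push_cast
  refine IsCoprime.mul_dvd ?_ h2 ?_
  · refine IsCoprime.pow_left ?_
    rw [Prime.coprime_iff_not_dvd (Nat.prime_iff_prime_int.1 hpf.out)]
    exact_mod_cast hm
  · refine h1.trans ?_
    simpa using sub_dvd_pow_sub_pow (u : ℤ) 1 k

lemma zeta_odd {σ : M ≃ₐ[ℚ] M} (hσ : σ ∈ L.I) {ζ : M} {n e m : ℕ} (hζ : IsPrimitiveRoot ζ n) (hn : 0 < n) (hnm : n = p ^ (e + 1) * m)
    (hm : ¬ p ∣ m) (hf : σ (ζ ^ (p ^ e * m)) = ζ ^ (p ^ e * m)) : (σ ^ (p ^ e)) ζ = ζ := by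
  obtain ⟨u, hu, h1⟩ := L.zeta_u hσ hζ hn hnm hm
  refine glue hζ hn hnm hm hu h1 ?_
  rw [map_pow, hu, ← pow_mul, prim_pow_eq hζ hn, hnm] at hf
  have h3 : (p : ℤ) ∣ (u : ℤ) - 1 := by
    have h2 : ((p : ℤ) ^ e * m) * p ∣ ((p : ℤ) ^ e * m) * ((u : ℤ) - 1) := by
      push_cast at hf
      convert hf using 1 <;> ring
    have hm0 : m ≠ 0 := by rintro rfl; simp at hm
    have hp0 := hpf.out.ne_zero
    exact (mul_dvd_mul_iff_left (by positivity)).1 h2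
  simpa using dvd_sub_pow_of_dvd_sub h3 e
end LD

lemma LD.zeta_two {M : Type*} [Field M] [Algebra ℚ M] [FiniteDimensional ℚ M] (L : LD M 2) 
    {σ : M ≃ₐ[ℚ] M} (hσ : σ ∈ L.I) {ζ : M} {n e m : ℕ} (hζ : IsPrimitiveRoot ζ n) (hn : 0 < n) (hnm : n = 2 ^ (e + 3) * m)
    (hm : ¬ 2 ∣ m) : (σ ^ (2 ^ (e + 1))) ζ = ζ := by
  haveI : Fact (Nat.Prime 2) := ⟨Nat.prime_two⟩
  obtain ⟨u, hu, h1⟩ := L.zeta_u hσ hζ hn hnm hm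
  refine LD.glue hζ hn hnm hm hu h1 ?_
  refine two_pow_dvd _ ?_ e
  intro h2
  have h3 : IsPrimitiveRoot (ζ ^ u) n := hu ▸ hζ.map_of_injective σ.injective
  have h4 := (hζ.pow_iff_coprime hn u).1 h3
  have h5 : 2 ∣ n := by rw [hnm, pow_succ]; exact ⟨2 ^ (e + 2) * m, by ring⟩
  have h6 : 2 ∣ u := by exact_mod_cast h2
  have := Nat.dvd_gcd h6 h5
  rw [h4] at this
  norm_num at this

end

section
open WithZero
set_option linter.unusedSectionVars false
set_option linter.style.haveILetI false

lemma quad {M : Type*} [Field M] [NumberField M] [IsGalois ℚ M] (c : M ≃ₐ[ℚ] M) (ι : M →+* ℂ)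
    (hι : ∀ x, ι (c x) = starRingEnd ℂ (ι x)) (χ : (M ≃ₐ[ℚ] M) →* Mˣ) (h2 : ∀ σ, χ σ ^ 2 = 1) (hχc : χ c = 1)
    (hodd : ∀ q : ℕ, q.Prime → q ≠ 2 → ∃ L : LD M q, ∀ σ ∈ L.I, χ σ = 1) :
    ∃ x : M, x ≠ 0 ∧ (∀ σ : M ≃ₐ[ℚ] M, σ x = χ σ * x) ∧ (x ^ 2 = 1 ∨ x ^ 2 = 2) := by
  have hpm : ∀ σ, ((χ σ : Mˣ) : M) = 1 ∨ ((χ σ : Mˣ) : M) = -1 := fun σ => by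
    have := congrArg Units.val (h2 σ)
    push_cast at this
    exact sq_eq_one_iff.1 this
  obtain ⟨x, hx0, hx⟩ := LD.resolvent (⊤ : Subgroup (M ≃ₐ[ℚ] M)) (χ.comp (Subgroup.subtype ⊤)) (by
    intro σ τ
    simp only [MonoidHom.comp_apply, Subgroup.coe_subtype]
    rcases hpm τ with h | h <;> rw [h] <;> simp)
  have hx' : ∀ σ : M ≃ₐ[ℚ] M, σ x = χ σ * x := fun σ => hx ⟨σ, trivial⟩
  have hfix : ∀ σ : M ≃ₐ[ℚ] M, σ (x ^ 2) = x ^ 2 := by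
    intro σ
    rw [map_pow, hx', mul_pow]
    rcases hpm σ with h | h <;> rw [h] <;> simp
  obtain ⟨r, hr⟩ : ∃ r : ℚ, algebraMap ℚ M r = x ^ 2 := by
    have := (IsGalois.mem_bot_iff_fixed (F := ℚ) (E := M) (x ^ 2)).2 hfix
    exact this
  have hcx : c x = x := by rw [hx', hχc]; simp
  have hrpos : 0 < r := by
    have h3 := hι x
    rw [hcx, eq_comm, Complex.conj_eq_iff_real] at h3
    obtain ⟨y, hy⟩ := h3
    have h4 : ((r : ℝ) : ℂ) = ((y ^ 2 : ℝ) : ℂ) := by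
      have := congrArg ι hr
      rw [map_pow, hy] at this
      push_cast
      rw [← this]
      simp
    have h5 : (r : ℝ) = y ^ 2 := by exact_mod_cast h4
    have hy0 : y ≠ 0 := by
      rintro rfl
      rw [Complex.ofReal_zero] at hy
      exact hx0 ((map_eq_zero ι).1 hy)
    have : (0 : ℝ) < r := by rw [h5]; positivity
    exact_mod_cast this
  -- clear denominators
  obtain ⟨a, ha⟩ : ∃ a : ℕ, r.num = a := ⟨r.num.toNat, (Int.toNat_of_nonneg (Rat.num_pos.2 hrpos).le).symm⟩
  have ha0 : 0 < a := by have := Rat.num_pos.2 hrpos; omega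
  obtain ⟨D, m, hDm, hsq⟩ := Nat.sq_mul_squarefree (a * r.den)
  have hm0 : m ≠ 0 := by
    rintro rfl
    have := Nat.mul_pos ha0 r.den_pos
    simp at hDm; omega
  have hmM : (m : M) ≠ 0 := by exact_mod_cast hm0
  have hdM : (r.den : M) ≠ 0 := by exact_mod_cast r.den_nz
  obtain ⟨y, hy⟩ : ∃ y, y = (r.den : M) * x / m := ⟨_, rfl⟩
  have hyD : y ^ 2 = D := by
    have h3 : (x ^ 2) * r.den = a := by
      rw [← hr]
      have : r * r.den = a := by rw [Rat.mul_den_eq_num, ha]; simp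
      have := congrArg (algebraMap ℚ M) this
      rw [map_mul, map_natCast, map_natCast] at this
      exact this
    have h4 : (m : M) ^ 2 * D = a * r.den := by exact_mod_cast hDm
    rw [hy]
    field_simp
    linear_combination (r.den : M) * h3 - h4
  have hy0 : y ≠ 0 := by rw [hy]; exact div_ne_zero (mul_ne_zero hdM hx0) hmM
  have hyσ : ∀ σ : M ≃ₐ[ℚ] M, σ y = χ σ * y := by
    intro σ
    rw [hy, map_div₀, map_mul, hx', map_natCast, map_natCast]; ring
  refine ⟨y, hy0, hyσ, ?_⟩
  have hodd' : ∀ q : ℕ, q.Prime → q ∣ D → q = 2 := by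
    intro q hq hqD
    by_contra hq2
    haveI : Fact q.Prime := ⟨hq⟩
    obtain ⟨L, hL⟩ := hodd q hq hq2
    obtain ⟨k, hk⟩ := L.hW L.I le_rfl y hy0 (fun σ hσ => by rw [hyσ, hL σ hσ]; simp)
    obtain ⟨E, rfl⟩ := hqD
    have hE : ¬ q ∣ E := by
      rintro ⟨E', rfl⟩
      have : IsUnit q := hsq q ⟨E', by ring⟩
      exact hq.one_lt.ne' (Nat.isUnit_iff.1 this)
    have h3 := congrArg L.v hyD
    rw [map_pow, hk, Nat.cast_mul, map_mul, VL.nat_eq_one L.v L.hvp hE, mul_one, L.hp, ← exp_nsmul, exp_inj] at h3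
    have : (0 : ℤ) < (Nat.card L.I : ℤ) := by exact_mod_cast Nat.card_pos
    simp only [nsmul_eq_mul, Nat.cast_ofNat] at h3
    have h4 : (Nat.card L.I : ℤ) * (2 * k + 1) = 0 := by linear_combination h3
    rcases mul_eq_zero.1 h4 with h | h <;> omega
  have hD0 : D ≠ 0 := hsq.ne_zero
  have hD : D = 1 ∨ D = 2 := by
    by_cases h1 : D = 1
    · exact Or.inl h1
    right
    obtain ⟨q, hq, hqD⟩ := Nat.exists_prime_and_dvd h1
    obtain rfl := hodd' q hq hqD
    obtain ⟨E, rfl⟩ := hqD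
    by_cases hE1 : E = 1
    · rw [hE1]
    obtain ⟨q', hq', hqE⟩ := Nat.exists_prime_and_dvd hE1
    obtain rfl := hodd' q' hq' (hqE.mul_left 2)
    obtain ⟨E', rfl⟩ := hqE
    have : IsUnit 2 := hsq 2 ⟨E', by ring⟩
    exact absurd (Nat.isUnit_iff.1 this) (by norm_num)
  rcases hD with rfl | rfl
  · left; simpa using hyD
  · right; simpa using hyD

end

section
open IsDedekindDomain WithZero NumberField
set_option linter.unusedSectionVars false
set_option linter.style.haveILetI false

namespace LD
section
variable {M : Type*} [Field M] [NumberField M] [IsGalois ℚ M]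

lemma loc_odd {p : ℕ} [Fact p.Prime] (L : LD M p) (hc : ∀ a b : M ≃ₐ[ℚ] M, a * b = b * a) (hodd : p ≠ 2)
    {ζ α : M} {n e m d : ℕ} (hζ : IsPrimitiveRoot ζ n) (hn : 0 < n) (hnm : n = p ^ (e + 1) * m) (hm : ¬ p ∣ m)
    (hd : 0 < d) (hde : d ≤ e) (hαd : ∀ σ : M ≃ₐ[ℚ] M, (σ ^ d) α = α)
    (hgen : ∀ σ : M ≃ₐ[ℚ] M, σ α = α → σ ζ = ζ → σ = 1) : Nat.card L.I ≤ (p - 1) * p ^ e := by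
  have hp : p.Prime := Fact.out
  have h1 : IsPrimitiveRoot (ζ ^ (p ^ e * m)) p := hζ.pow hn (by rw [hnm]; ring)
  obtain ⟨f, rfl⟩ : ∃ f, e = f + 1 := ⟨e - 1, by omega⟩
  refine L.card_I_odd h1 hc hodd (ζ₂ := ζ ^ (p ^ f * m)) (by rw [← pow_mul]; congr 1; ring) _ ?_
  intro σ hσ hf
  refine hgen _ ?_ (L.zeta_odd hσ hζ hn hnm hm hf)
  obtain ⟨j, hj⟩ := L.isPGroup_W h1 hc ⟨σ, (L.mem_W h1).2 ⟨hσ, hf⟩⟩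
  exact fix_pow_alpha σ hp hd (congrArg Subtype.val hj) (hαd σ) hde

lemma loc_two (L : LD M 2) (hc : ∀ a b : M ≃ₐ[ℚ] M, a * b = b * a)
    {ζ α : M} {n e m d : ℕ} (hζ : IsPrimitiveRoot ζ n) (hn : 0 < n) (hnm : n = 2 ^ (e + 3) * m) (hm : ¬ 2 ∣ m)
    (hd : 0 < d) (hde : d ≤ e + 1) (hαd : ∀ σ : M ≃ₐ[ℚ] M, (σ ^ d) α = α)
    (hgen : ∀ σ : M ≃ₐ[ℚ] M, σ α = α → σ ζ = ζ → σ = 1) : ∀ σ ∈ L.I, σ ^ (2 ^ (e + 1)) = 1 := by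
  haveI : Fact (Nat.Prime 2) := ⟨Nat.prime_two⟩
  intro σ hσ
  have h1 : IsPrimitiveRoot (-1 : M) 2 := IsPrimitiveRoot.neg_one 0 (by decide)
  refine hgen _ ?_ (L.zeta_two hσ hζ hn hnm hm)
  obtain ⟨j, hj⟩ := L.isPGroup_W h1 hc ⟨σ, (L.mem_W h1).2 ⟨hσ, by simp⟩⟩
  exact fix_pow_alpha σ Nat.prime_two hd (congrArg Subtype.val hj) (hαd σ) hde

lemma loc_triv {p : ℕ} [Fact p.Prime] (L : LD M p) {ζ α : M} {n N : ℕ} (hζ : IsPrimitiveRoot ζ n) (hpn : ¬ p ∣ n) (hpN : ¬ p ∣ N)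
    (hα : IsIntegral ℤ α) (hαN : ∀ σ : M ≃ₐ[ℚ] M, σ α ≠ α → ∃ γ, IsIntegral ℤ γ ∧ (σ α - α) * γ = N)
    (hgen : ∀ σ : M ≃ₐ[ℚ] M, σ α = α → σ ζ = ζ → σ = 1) : ∀ σ ∈ L.I, σ = 1 := fun σ hσ =>
  hgen σ (L.fix_alpha hσ hpN hα (hαN σ)) (L.fix_root hσ hpn hζ.pow_eq_one)
end
end LD

lemma conj_root {M : Type*} [Field M] [Algebra ℚ M] (c : M ≃ₐ[ℚ] M) (ι : M →+* ℂ)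
    (hι : ∀ x, ι (c x) = starRingEnd ℂ (ι x)) {ζ : M} {n : ℕ} (hn : n ≠ 0) (h : ζ ^ n = 1) : c ζ = ζ⁻¹ := by
  apply ι.injective
  rw [hι, map_inv₀]
  have h1 : ‖ι ζ‖ = 1 := Complex.norm_eq_one_of_pow_eq_one (n := n) (by rw [← map_pow, h, map_one]) hn
  rw [Complex.inv_def, Complex.normSq_eq_norm_sq, h1]; simp

theorem global_bound {M : Type*} [Field M] [NumberField M] [IsGalois ℚ M] (hc : ∀ a b : M ≃ₐ[ℚ] M, a * b = b * a)
    (c : M ≃ₐ[ℚ] M) (ι : M →+* ℂ) (hι : ∀ x, ι (c x) = starRingEnd ℂ (ι x)) (N d : ℕ) (hN : 0 < N) (hd : 0 < d)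
    (n : ℕ) (hn : n = (2 * N) ^ (d + 3)) (ζ : M) (hζ : IsPrimitiveRoot ζ n) (α : M) (hα : IsIntegral ℤ α)
    (hαN : ∀ σ : M ≃ₐ[ℚ] M, σ α ≠ α → ∃ γ, IsIntegral ℤ γ ∧ (σ α - α) * γ = N)
    (hαd : ∀ σ : M ≃ₐ[ℚ] M, (σ ^ d) α = α) (hgen : ∀ σ : M ≃ₐ[ℚ] M, σ α = α → σ ζ = ζ → σ = 1) :
    Nat.card (M ≃ₐ[ℚ] M) ≤ Nat.totient n := by
  have hn0 : 0 < n := by rw [hn]; positivity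
  choose P L hPL using fun (p : ℕ) (hp : p.Prime) => exists_LD' M p hp
  let I : ℕ → Subgroup (M ≃ₐ[ℚ] M) := fun p => if h : p.Prime then (L p h).I else ⊥
  have hI : ∀ p (hp : p.Prime), I p = (L p hp).I := fun p hp => dif_pos hp
  let T : Finset ℕ := n.primeFactors.erase 2
  have hT : ∀ q ∈ T, q.Prime ∧ q ≠ 2 ∧ q ∣ n := fun q hq => by
    simp only [T, Finset.mem_erase, Nat.mem_primeFactors] at hq
    exact ⟨hq.2.1, hq.1, hq.2.2.1⟩
  have hfac : ∀ q, q.Prime → q ∣ n → ∃ e m, n = q ^ (e + 3) * m ∧ ¬ q ∣ m ∧ d ≤ e ∧ n.factorization q = e + 3 := by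
    intro q hq hqn
    have h1 : d + 3 ≤ n.factorization q := by
      rw [← hq.pow_dvd_iff_le_factorization hn0.ne', hn]
      exact pow_dvd_pow_of_dvd (hq.dvd_of_dvd_pow (hn ▸ hqn)) _
    refine ⟨n.factorization q - 3, n / q ^ n.factorization q, ?_, Nat.not_dvd_ordCompl hq hn0.ne', by omega, by omega⟩
    rw [Nat.sub_add_cancel (by omega)]
    exact (Nat.ordProj_mul_ordCompl_eq_self n q).symm
  have h2n : 2 ∣ n := by rw [hn]; exact dvd_pow (dvd_mul_right _ _) (by omega)
  have htriv : ∀ q (hq : q.Prime), ¬ q ∣ n → ∀ σ ∈ (L q hq).I, σ = 1 := by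
    intro q hq hqn
    haveI : Fact q.Prime := ⟨hq⟩
    refine (L q hq).loc_triv hζ hqn ?_ hα hαN hgen
    intro h; apply hqn; rw [hn]; exact dvd_pow (h.mul_left 2) (by omega)
  have hgenT : I 2 ⊔ T.sup I = ⊤ := by
    refine gen_top hc _ fun p hp => ⟨P p hp, L p hp, hPL p hp, ?_⟩
    by_cases hpn : p ∣ n
    · by_cases hp2 : p = 2
      · subst hp2; rw [← hI]; exact le_sup_left
      · rw [← hI p hp]
        refine le_trans (Finset.le_sup (f := I) ?_) le_sup_right
        simp only [T, Finset.mem_erase, Nat.mem_primeFactors]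
        exact ⟨hp2, hp, hpn, hn0.ne'⟩
    · intro σ hσ
      rw [htriv p hp hpn σ hσ]; exact one_mem _
  obtain ⟨e2, m2, hnm2, hm2, hde2, hf2⟩ := hfac 2 Nat.prime_two h2n
  let z8 : M := ζ ^ (2 ^ e2 * m2)
  have hz8 : IsPrimitiveRoot z8 8 := hζ.pow hn0 (by rw [hnm2]; ring)
  have hz80 : z8 ≠ 0 := hz8.ne_zero (by norm_num)
  have hz84 : z8 ^ 4 = -1 := by
    have h1 : IsPrimitiveRoot (z8 ^ 4) 2 := hz8.pow (by norm_num) (by norm_num)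
    exact h1.eq_neg_one_of_two_right
  let t : M := z8 + z8⁻¹
  have ht2 : t ^ 2 = 2 := by
    simp only [t]; field_simp; linear_combination hz84
  have ht0 : t ≠ 0 := by
    intro h; rw [h] at ht2; norm_num at ht2
  have hσt : ∀ σ : M ≃ₐ[ℚ] M, (σ t / t) ^ 2 = 1 := by
    intro σ
    rw [div_pow, ← map_pow, ht2, map_ofNat]; norm_num
  have hpm : ∀ σ : M ≃ₐ[ℚ] M, σ t / t = 1 ∨ σ t / t = -1 := fun σ => sq_eq_one_iff.1 (hσt σ)
  let ψ : (M ≃ₐ[ℚ] M) →* Mˣ := MonoidHom.toHomUnits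
    { toFun := fun σ => σ t / t
      map_one' := by simp [ht0]
      map_mul' := fun a b => by
        have h1 : (a * b) t = a (b t / t) * a t := by
          rw [← map_mul, div_mul_cancel₀ _ ht0]; rfl
        rw [h1]
        rcases hpm b with h | h <;> rw [h] <;> simp [neg_div] }
  have hψ : ∀ σ, ((ψ σ : Mˣ) : M) = σ t / t := fun σ => rfl
  have hψ1 : ∀ σ, σ t = t → ψ σ = 1 := fun σ h => by
    apply Units.ext; rw [hψ, h, div_self ht0]; rfl
  letI : CommGroup (M ≃ₐ[ℚ] M) := { (inferInstance : Group (M ≃ₐ[ℚ] M)) with mul_comm := hc }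
  have key := card_global (A := M ≃ₐ[ℚ] M) (M := M) I c ?_ T hgenT (fun q => (q - 1) * q ^ (n.factorization q - 1)) ?_ (e2 + 1) ?_ ψ ?_ ?_ ?_ ?_
  · refine key.trans (le_of_eq ?_)
    rw [Nat.totient_eq_prod_factorization hn0.ne', Finsupp.prod, Nat.support_factorization, 
      ← Finset.mul_prod_erase _ _ (show 2 ∈ n.primeFactors from Nat.mem_primeFactors.2 ⟨Nat.prime_two, h2n, hn0.ne'⟩), hf2]
    have : ∀ q, (q - 1) * q ^ (n.factorization q - 1) = q ^ (n.factorization q - 1) * (q - 1) := fun q => mul_comm _ _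
    simp only [this]
    simp only [T]
    rw [show e2 + 3 - 1 = e2 + 1 + 1 by omega, pow_succ 2 (e2 + 1)]
    ring
  · apply AlgEquiv.ext; intro x
    apply ι.injective
    change ι (c (c x)) = ι x
    rw [hι, hι]; simp
  · intro q hq
    obtain ⟨hq1, hq2, hq3⟩ := hT q hq
    obtain ⟨e, m, hnm, hm, hde, hf⟩ := hfac q hq1 hq3
    haveI : Fact q.Prime := ⟨hq1⟩
    rw [hI q hq1]
    simp only [hf]
    exact (L q hq1).loc_odd hc hq2 (e := e + 2) hζ hn0 hnm hm hd (by omega) hαd hgen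
  · rw [hI 2 Nat.prime_two]
    exact (L 2 Nat.prime_two).loc_two hc hζ hn0 hnm2 hm2 hd (by omega) hαd hgen
  · intro σ; apply Units.ext; exact hσt σ
  · apply hψ1
    have := conj_root c ι hι (by norm_num) hz8.pow_eq_one
    simp only [t]
    rw [map_add, map_inv₀, this, inv_inv, add_comm]
  · intro q hq σ hσ
    obtain ⟨hq1, hq2, hq3⟩ := hT q hq
    haveI : Fact q.Prime := ⟨hq1⟩
    rw [hI q hq1] at hσ
    have : σ z8 = z8 := (L q hq1).fix_root hσ (m := 8) (fun h => hq2 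
      ((Nat.prime_dvd_prime_iff_eq hq1 Nat.prime_two).1 (hq1.dvd_of_dvd_pow (show q ∣ 2 ^ 3 from h)))) hz8.pow_eq_one
    apply hψ1
    simp only [t]
    rw [map_add, map_inv₀, this]
  · intro χ hχ2 hχc hχI σ hσ
    obtain ⟨x, hx0, hx, hx2⟩ := quad c ι hι χ hχ2 hχc (fun q hq hq2 => by
      refine ⟨L q hq, fun σ hσ => ?_⟩
      by_cases hqn : q ∣ n
      · refine hχI q ?_ σ (by rw [hI q hq]; exact hσ)
        simp only [T, Finset.mem_erase, Nat.mem_primeFactors]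
        exact ⟨hq2, hq, hqn, hn0.ne'⟩
      · rw [htriv q hq hqn σ hσ, map_one])
    have hst : σ t = t := by
      have := congrArg Units.val hσ
      rw [hψ] at this
      simpa [div_eq_one_iff_eq ht0] using this
    have hsx : σ x = x := by
      rcases hx2 with h | h
      · rcases sq_eq_one_iff.1 h with h | h <;> rw [h] <;> simp
      · rw [← ht2] at h
        rcases sq_eq_sq_iff_eq_or_eq_neg.1 h with h | h <;> rw [h] <;> simp [hst]
    apply Units.ext
    have := hx σ
    rw [hsx] at this
    exact mul_right_cancel₀ hx0 (this.symm.trans (one_mul x).symm)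

end

section
open NumberField
set_option linter.unusedSectionVars false
set_option linter.style.haveILetI false

lemma exists_cofactor {K : Type*} [Field K] [NumberField K] {δ : K} (hδ : IsIntegral ℤ δ) (h0 : δ ≠ 0) :
    ∃ (n : ℕ) (γ : K), 0 < n ∧ IsIntegral ℤ γ ∧ δ * γ = n := by
  let D : 𝓞 K := ⟨δ, hδ⟩
  have hD : D ≠ 0 := fun h => h0 (congrArg Subtype.val h)
  have h1 := Ideal.absNorm_mem (Ideal.span {D})
  rw [Ideal.mem_span_singleton] at h1
  obtain ⟨γ, hγ⟩ := h1
  refine ⟨Ideal.absNorm (Ideal.span {D}), γ, ?_, γ.2, ?_⟩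
  rotate_left
  · have := congrArg (algebraMap (𝓞 K) K) hγ
    rw [map_natCast, map_mul] at this
    exact this.symm
  · rw [Nat.pos_iff_ne_zero, Ne, Ideal.absNorm_eq_zero_iff, Ideal.span_singleton_eq_bot]; exact hD

lemma fix_top {M : Type*} [Field M] [Algebra ℚ M] (S : Set M) (hS : IntermediateField.adjoin ℚ S = ⊤) (σ : M ≃ₐ[ℚ] M)
    (h : ∀ x ∈ S, σ x = x) : σ = 1 := by
  have h1 : IntermediateField.adjoin ℚ S ≤ IntermediateField.fixedField (Subgroup.zpowers σ) := by
    rw [IntermediateField.adjoin_le_iff]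
    intro x hx
    rw [SetLike.mem_coe, IntermediateField.mem_fixedField_iff]
    intro f hf
    have : Subgroup.zpowers σ ≤ MulAction.stabilizer (M ≃ₐ[ℚ] M) x := by
      rw [Subgroup.zpowers_le]; exact h x hx
    exact this hf
  rw [hS] at h1
  apply AlgEquiv.ext
  intro x
  exact (IntermediateField.mem_fixedField_iff _ _).1 (h1 (trivial : x ∈ ⊤)) σ (Subgroup.mem_zpowers σ)

lemma exists_int_gen (K : Type*) [Field K] [NumberField K] :
    ∃ α : K, IsIntegral ℤ α ∧ ∀ σ : K ≃ₐ[ℚ] K, σ α = α → σ = 1 := by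
  obtain ⟨a, ha⟩ := Field.exists_primitive_element ℚ K
  obtain ⟨y, hy0, hy⟩ := ((IsFractionRing.isAlgebraic_iff ℤ ℚ K).2 (Algebra.IsAlgebraic.isAlgebraic a)).exists_integral_multiple
  refine ⟨y • a, hy, fun σ hσ => ?_⟩
  rw [map_zsmul] at hσ
  have h1 : σ a = a := by
    have hyK : (y : K) ≠ 0 := by exact_mod_cast hy0
    rw [zsmul_eq_mul, zsmul_eq_mul] at hσ
    exact mul_left_cancel₀ hyK hσ
  refine fix_top {a} ha σ ?_
  rintro x rfl; exact h1

open scoped Classical in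
theorem card_bound (K : Type*) [Field K] [NumberField K] [IsGalois ℚ K] (hK : ∀ a b : K ≃ₐ[ℚ] K, a * b = b * a) :
    ∃ n : ℕ, 0 < n ∧ ∀ (M : Type) [Field M] [NumberField M] [IsGalois ℚ M] [Algebra K M] 
      (c : M ≃ₐ[ℚ] M) (ι : M →+* ℂ) (_ : ∀ x, ι (c x) = starRingEnd ℂ (ι x)) (ζ : M) (_ : IsPrimitiveRoot ζ n)
      (_ : ∀ σ : M ≃ₐ[ℚ] M, (∀ x : K, σ (algebraMap K M x) = algebraMap K M x) → σ ζ = ζ → σ = 1), 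
      Nat.card (M ≃ₐ[ℚ] M) ≤ Nat.totient n := by
  obtain ⟨α, hα, hgα⟩ := exists_int_gen K
  have h1 : ∀ σ : K ≃ₐ[ℚ] K, ∃ (n : ℕ) (γ : K), 0 < n ∧ IsIntegral ℤ γ ∧ (σ α ≠ α → (σ α - α) * γ = n) := by
    intro σ
    by_cases h : σ α = α
    · exact ⟨1, 1, one_pos, isIntegral_one, fun h' => absurd h h'⟩
    · obtain ⟨n, γ, h1, h2, h3⟩ := exists_cofactor ((hα.map (σ : K →ₐ[ℚ] K)).sub hα) (sub_ne_zero.2 h)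
      exact ⟨n, γ, h1, h2, fun _ => h3⟩
  choose ν γ hν hγ hνγ using h1
  let d := Nat.card (K ≃ₐ[ℚ] K)
  have hd : 0 < d := Nat.card_pos
  let N := ∏ σ, ν σ
  have hN : 0 < N := Finset.prod_pos fun σ _ => hν σ
  refine ⟨(2 * N) ^ (d + 3), by positivity, ?_⟩
  intro M _ _ _ _ c ι hι ζ hζ hgen
  let r : (M ≃ₐ[ℚ] M) →* (K ≃ₐ[ℚ] K) := AlgEquiv.restrictNormalHom K
  have hr : ∀ (σ : M ≃ₐ[ℚ] M) (x : K), algebraMap K M (r σ x) = σ (algebraMap K M x) := fun σ x => 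
    AlgEquiv.restrictNormal_commutes σ K x
  have hinj := (algebraMap K M).injective
  have hn0 : (2 * N) ^ (d + 3) ≠ 0 := by positivity
  have hgen' : ∀ σ : M ≃ₐ[ℚ] M, r σ = 1 → σ ζ = ζ → σ = 1 := by
    intro σ h
    refine hgen σ fun x => ?_
    rw [← hr, h]; rfl
  have hgen2 : ∀ σ : M ≃ₐ[ℚ] M, σ (algebraMap K M α) = algebraMap K M α → σ ζ = ζ → σ = 1 := by
    intro σ h
    refine hgen' σ (hgα _ (hinj ?_))
    rw [hr, h]
  refine global_bound ?_ c ι hι N d hN hd _ rfl ζ hζ (algebraMap K M α) (hα.map (Algebra.ofId K M : K →ₐ[K] M)) ?_ ?_ hgen2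
  · intro a b
    have hz : ∀ σ : M ≃ₐ[ℚ] M, ∃ u : ℕ, σ ζ = ζ ^ u := fun σ => by
      haveI : NeZero ((2 * N) ^ (d + 3)) := ⟨hn0⟩
      obtain ⟨u, -, hu⟩ := hζ.eq_pow_of_pow_eq_one (show (σ ζ) ^ _ = 1 by rw [← map_pow, hζ.pow_eq_one, map_one])
      exact ⟨u, hu.symm⟩
    have : (b * a)⁻¹ * (a * b) = 1 := by
      apply hgen'
      · rw [map_mul, map_inv, map_mul, map_mul, hK, hK (r a)]; simp
      · rw [AlgEquiv.mul_apply, AlgEquiv.aut_inv, AlgEquiv.symm_apply_eq, AlgEquiv.mul_apply, AlgEquiv.mul_apply]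
        obtain ⟨u, hu⟩ := hz a
        obtain ⟨w, hw⟩ := hz b
        rw [hw, map_pow, hu, map_pow, hw, ← pow_mul, ← pow_mul, mul_comm]
    exact (inv_mul_eq_one.1 this).symm
  · intro σ hσ
    have h2 : r σ α ≠ α := fun h => hσ (by rw [← hr, h])
    refine ⟨algebraMap K M (γ (r σ) * ∏ τ ∈ Finset.univ.erase (r σ), (ν τ : K)), ?_, ?_⟩
    · refine IsIntegral.map (Algebra.ofId K M : K →ₐ[K] M) ((hγ _).mul ?_)
      exact IsIntegral.prod _ fun τ _ => isIntegral_natCast _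
    · rw [← hr, ← map_sub, ← map_mul, ← mul_assoc, hνγ _ h2, Finset.mul_prod_erase _ (fun τ => (ν τ : K)) (Finset.mem_univ _)]
      simp [N]
  · intro σ
    rw [← hr, map_pow, pow_card_eq_one']
    rfl

end

section
open NumberField
set_option linter.unusedSectionVars false
set_option linter.style.haveILetI false

lemma nrm {K : Type*} [Field K] (a b : Algebra ℚ K) (h : @Normal ℚ K _ _ a) : @Normal ℚ K _ _ b := by
  obtain rfl : a = b := Subsingleton.elim _ _
  exact h

theorem kronecker_weber (K : IntermediateField ℚ ℂ) [FiniteDimensional ℚ K] [IsGalois ℚ K] 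
    (hK : ∀ a b : K ≃ₐ[ℚ] K, a * b = b * a) : 
    ∃ (n : ℕ) (ξ : ℂ), 0 < n ∧ ξ ^ n = 1 ∧ ∀ x ∈ K, x ∈ Algebra.adjoin ℚ ({ξ} : Set ℂ) := by
  haveI : NumberField K := { }
  obtain ⟨n, hn, H⟩ := card_bound K hK
  haveI : NeZero n := ⟨hn.ne'⟩
  have hξ := Complex.isPrimitiveRoot_exp n hn.ne'
  obtain ⟨ξ, hξdef⟩ : ∃ ξ, ξ = Complex.exp (2 * Real.pi * Complex.I / n) := ⟨_, rfl⟩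
  rw [← hξdef] at hξ
  let E : IntermediateField ℚ ℂ := IntermediateField.adjoin ℚ {ξ}
  haveI hcyc : IsCyclotomicExtension {n} ℚ E := by
    change IsCyclotomicExtension {n} ℚ (IntermediateField.adjoin ℚ {ξ}).toSubalgebra
    rw [IntermediateField.adjoin_simple_toSubalgebra_of_isAlgebraic ((hξ.isIntegral hn).tower_top.isAlgebraic)]
    exact hξ.adjoin_isCyclotomicExtension ℚ
  haveI : FiniteDimensional ℚ E := IsCyclotomicExtension.finiteDimensional {n} ℚ E
  haveI : IsGalois ℚ E := IsCyclotomicExtension.isGalois {n} ℚ E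
  have hE : Module.finrank ℚ E = Nat.totient n := IsCyclotomicExtension.finrank E (Polynomial.cyclotomic.irreducible_rat hn)
  let M : IntermediateField ℚ ℂ := K ⊔ E
  haveI : FiniteDimensional ℚ M := IntermediateField.finiteDimensional_sup K E
  haveI : Normal ℚ K := IsGalois.to_normal
  haveI : Normal ℚ E := IsGalois.to_normal
  haveI : Normal ℚ M := by
    haveI := nrm _ K.algebra' ‹Normal ℚ K›
    haveI := nrm _ E.algebra' ‹Normal ℚ E›
    exact nrm _ _ (IntermediateField.normal_sup ℚ ℂ K E)
  haveI : IsGalois ℚ M := { }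
  haveI : NumberField M := { }
  letI : Algebra K M := (IntermediateField.inclusion (le_sup_left : K ≤ M)).toAlgebra
  have hξM : ξ ∈ M := (le_sup_right : E ≤ M) (IntermediateField.mem_adjoin_simple_self ℚ ξ)
  let c : M ≃ₐ[ℚ] M := (Complex.conjAe.restrictScalars ℚ).restrictNormal M
  have hMeq : M = IntermediateField.adjoin ℚ ((K : Set ℂ) ∪ {ξ}) := by
    rw [IntermediateField.adjoin_union, IntermediateField.adjoin_self]
  have key := H M c (algebraMap M ℂ) (fun x => AlgEquiv.restrictNormal_commutes _ M x) ⟨ξ, hξM⟩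
    (IsPrimitiveRoot.of_map_of_injective (f := algebraMap M ℂ) hξ (algebraMap M ℂ).injective) (by
      intro σ h1 h2
      have : (σ : M →ₐ[ℚ] M) = AlgHom.id ℚ M := by
        refine IntermediateField.algHom_ext_of_eq_adjoin ℚ hMeq ?_
        rintro x (hx | hx)
        · exact h1 ⟨x, hx⟩
        · obtain rfl : x = ξ := hx
          exact h2
      apply AlgEquiv.ext
      intro x; exact DFunLike.congr_fun this x)
  rw [IsGalois.card_aut_eq_finrank, ← hE] at key
  have hEM : E = M := IntermediateField.eq_of_le_of_finrank_le le_sup_right key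
  refine ⟨n, ξ, hn, hξ.pow_eq_one, fun x hx => ?_⟩
  have hxE : x ∈ E := by rw [hEM]; exact (le_sup_left : K ≤ M) hx
  have hal : IsAlgebraic ℚ ξ := (hξ.isIntegral hn).tower_top.isAlgebraic
  have := IntermediateField.adjoin_simple_toSubalgebra_of_isAlgebraic hal
  rw [← this]; exact hxE

end

section
open Matrix in
lemma sm_inv_symm {I : Type*} [Fintype I] [DecidableEq I] (σ : I → I) (G : Matrix I I ℂ)
    (hsym : ∀ i j, G i j = G j i) (horth : ∀ i l, ∑ j, G (σ i) j * G j l = if i = l then 1 else 0) :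
    ∀ i j, G (σ i) j = G (σ j) i := by
  let H : Matrix I I ℂ := fun i j => G (σ i) j
  have h1 : H * G = 1 := by
    ext i l; rw [Matrix.mul_apply, Matrix.one_apply]; exact horth i l
  have h2 : G * H = 1 := mul_eq_one_comm.1 h1
  have hG : Gᵀ = G := by ext i j; exact hsym j i
  have h3 : Hᵀ * G = 1 := by
    have := congrArg Matrix.transpose h2
    rwa [Matrix.transpose_mul, hG, Matrix.transpose_one] at this
  have h4 : Hᵀ = H := by
    calc Hᵀ = Hᵀ * (G * H) := by rw [h2, mul_one]
      _ = H := by rw [← mul_assoc, h3, one_mul]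
  intro i j
  exact congrFun (congrFun h4 j) i

open Matrix in
lemma sm_unitary {I : Type*} [Fintype I] [DecidableEq I] (z : I) (σ : I → I) (hσ : ∀ i, σ (σ i) = i) (S : Matrix I I ℂ)
    (hsym : ∀ i j, S i j = S j i) (horth : ∀ i l, ∑ j, S (σ i) j * S j l = if i = l then 1 else 0)
    (hz' : ∀ i, S z i ≠ 0)
    (hN : ∀ i k j, ∃ n : ℕ, ∑ m, S i m * S k m * starRingEnd ℂ (S j m) / S z m = (n : ℂ)) :
    ∀ k j, ∑ m, S k m * starRingEnd ℂ (S j m) = if k = j then 1 else 0 := by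
  have h0 : ∀ k j, ∃ n : ℕ, ∑ m, S k m * starRingEnd ℂ (S j m) = (n : ℂ) := by
    intro k j
    obtain ⟨n, hn⟩ := hN z k j
    refine ⟨n, hn ▸ Finset.sum_congr rfl fun m _ => ?_⟩
    field_simp [hz' m]
  choose p hp using h0
  let C : Matrix I I ℂ := fun i l => if σ i = l then 1 else 0
  let B : Matrix I I ℂ := fun i j => starRingEnd ℂ (S i j)
  let P : Matrix I I ℂ := fun i j => (p i j : ℂ)
  have hC : S * S = C := by
    ext i l
    rw [Matrix.mul_apply]
    have := horth (σ i) l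
    rw [hσ] at this
    exact this
  have hB : B * B = C := by
    ext i l
    have := congrArg (starRingEnd ℂ) (congrFun (congrFun hC i) l)
    rw [Matrix.mul_apply, map_sum] at this
    rw [Matrix.mul_apply]
    simp only [B, ← map_mul]
    rw [this]
    simp only [C]
    split_ifs <;> simp
  have hCC : C * C = 1 := by
    ext i l
    rw [Matrix.mul_apply, Matrix.one_apply]
    simp only [C, ite_mul, one_mul, zero_mul, Finset.sum_ite_eq, Finset.mem_univ, if_true, hσ]
  have hP : S * B = P := by
    ext i j
    rw [Matrix.mul_apply]
    simp only [P, B, ← hp]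
    exact Finset.sum_congr rfl fun m _ => by rw [hsym m j]
  have hP' : B * S = P := by
    ext i j
    have := congrArg (starRingEnd ℂ) (congrFun (congrFun hP i) j)
    rw [Matrix.mul_apply, map_sum] at this
    rw [Matrix.mul_apply]
    simp only [P, B, map_mul, map_natCast, Complex.conj_conj] at this ⊢
    exact this
  have hPP : P * P = 1 := by
    calc P * P = S * (B * B) * S := by nth_rw 1 [← hP]; rw [← hP']; simp only [mul_assoc]
      _ = C * C := by rw [hB, ← hC]; simp only [mul_assoc]
      _ = 1 := hCC
  have hps : ∀ i j, p i j = p j i := by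
    intro i j
    have h1 := congrArg (starRingEnd ℂ) (hp i j)
    rw [map_sum, map_natCast] at h1
    have h2 := hp j i
    have : (p i j : ℂ) = p j i := by
      rw [← h1, ← h2]
      exact Finset.sum_congr rfl fun m _ => by rw [map_mul, Complex.conj_conj, mul_comm]
    exact_mod_cast this
  have hpp : ∀ i, ∑ j, p i j * p i j = 1 := by
    intro i
    have := congrFun (congrFun hPP i) i
    rw [Matrix.mul_apply, Matrix.one_apply_eq] at this
    have h2 : ((∑ j, p i j * p i j : ℕ) : ℂ) = 1 := by
      push_cast
      rw [← this]
      exact Finset.sum_congr rfl fun m _ => by simp only [P]; rw [hps m i]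
    exact_mod_cast h2
  have hdiag : ∀ i, p i i ≠ 0 := by
    intro i h
    have h1 := hp i i
    rw [h] at h1
    have h2 : ((∑ m, Complex.normSq (S i m) : ℝ) : ℂ) = 0 := by
      push_cast
      rw [← Nat.cast_zero, ← h1]
      exact Finset.sum_congr rfl fun m _ => by rw [Complex.mul_conj]
    have h3 : ∑ m, Complex.normSq (S i m) = 0 := by exact_mod_cast h2
    rw [Finset.sum_eq_zero_iff_of_nonneg (fun m _ => Complex.normSq_nonneg _)] at h3
    have := h3 z (Finset.mem_univ _)
    rw [Complex.normSq_eq_zero, hsym] at this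
    exact hz' i this
  intro k j
  rw [hp]
  have h1 := hpp k
  rw [← Finset.add_sum_erase _ _ (Finset.mem_univ k)] at h1
  have h2 : 1 ≤ p k k * p k k := Nat.mul_pos (Nat.pos_of_ne_zero (hdiag k)) (Nat.pos_of_ne_zero (hdiag k))
  split_ifs with hkj
  · subst hkj
    have h3 : p k k * p k k = 1 := by omega
    rw [Nat.eq_one_of_mul_eq_one_left h3]; simp
  · have h3 : ∑ j ∈ Finset.univ.erase k, p k j * p k j = 0 := by omega
    have := (Finset.sum_eq_zero_iff.1 h3) j (Finset.mem_erase.2 ⟨fun h => hkj h.symm, Finset.mem_univ _⟩)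
    rw [mul_self_eq_zero.1 this]; simp

/-- the Galois permutation lemma -/
lemma sm_perm {I : Type*} [Fintype I] [DecidableEq I] (z : I) (σ : I → I) (S G : Matrix I I ℂ)
    (hsym : ∀ i j, S i j = S j i) (horth : ∀ i l, ∑ j, S (σ i) j * S j l = if i = l then 1 else 0)
    (hz' : ∀ i, S z i ≠ 0)
    (hU : ∀ k j, ∑ m, S k m * starRingEnd ℂ (S j m) = if k = j then 1 else 0)
    (n : I → I → I → ℕ) (hn : ∀ i k m, S i m * S k m = S z m * ∑ j, (n i k j : ℂ) * S j m)
    (gsym : ∀ i j, G i j = G j i) (gorth : ∀ i l, ∑ j, G (σ i) j * G j l = if i = l then 1 else 0)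
    (gz' : ∀ i, G z i ≠ 0)
    (gn : ∀ i k m, G i m * G k m = G z m * ∑ j, (n i k j : ℂ) * G j m) :
    ∃ (τ : Equiv.Perm I) (ε : I → ℤ), (∀ i, ε i = 1 ∨ ε i = -1) ∧
      (∀ i j, G i j = ε i * S (τ i) j ∧ G i j = ε j * S i (τ j)) := by
  have hU' : ∀ k j, ∑ m, S m k * starRingEnd ℂ (S m j) = if k = j then 1 else 0 := fun k j => by
    rw [← hU]; exact Finset.sum_congr rfl fun m _ => by rw [hsym m k, hsym m j]
  have main : ∀ m, ∃ m' : I, ∃ e : ℂ, ∀ i, G i m = e * S i m' := by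
    intro m
    obtain ⟨a, haq⟩ : ∃ a : I → ℂ, ∀ q, a q = ∑ j, starRingEnd ℂ (S j q) * G j m := ⟨_, fun _ => rfl⟩
    have ha : ∀ j, G j m = ∑ q, a q * S j q := by
      intro j
      simp only [haq, Finset.sum_mul]
      rw [Finset.sum_comm]
      have : ∀ k, ∑ q, starRingEnd ℂ (S k q) * G k m * S j q = if j = k then G k m else 0 := by
        intro k
        have := congrArg (· * G k m) (hU j k)
        simp only [Finset.sum_mul, ite_mul, one_mul, zero_mul] at this
        rw [← this]
        exact Finset.sum_congr rfl fun q _ => by ring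
      simp only [this]; simp
    have hrel : ∀ i q, G i m * a q = G z m * a q * (S i q / S z q) := by
      intro i q
      have h1 : ∀ k, G i m * G k m = ∑ r, G z m * a r * (S i r / S z r) * S k r := by
        intro k
        have h2 : ∑ j, (n i k j : ℂ) * G j m = ∑ r, a r * ∑ j, (n i k j : ℂ) * S j r := by
          simp only [Finset.mul_sum]
          rw [Finset.sum_comm]
          refine Finset.sum_congr rfl fun j _ => ?_
          rw [ha j, Finset.mul_sum]
          exact Finset.sum_congr rfl fun q _ => by ring
        rw [gn, h2, Finset.mul_sum]
        refine Finset.sum_congr rfl fun r _ => ?_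
        have h3 : S i r / S z r * S k r = ∑ j, (n i k j : ℂ) * S j r := by
          rw [div_mul_eq_mul_div, hn, mul_div_cancel_left₀ _ (hz' r)]
        rw [← h3]; ring
      rw [haq q, Finset.mul_sum]
      have h4 : ∀ k, G i m * (starRingEnd ℂ (S k q) * G k m) = ∑ r, G z m * a r * (S i r / S z r) * (S k r * starRingEnd ℂ (S k q)) := by
        intro k
        rw [mul_left_comm, h1, Finset.mul_sum]
        exact Finset.sum_congr rfl fun r _ => by ring
      simp only [h4]
      rw [Finset.sum_comm, ← haq]
      simp only [← Finset.mul_sum, hU']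
      simp
    obtain ⟨q, hq⟩ : ∃ q, a q ≠ 0 := by
      by_contra! h
      exact gz' m (by rw [ha]; exact Finset.sum_eq_zero fun q _ => by rw [h q, zero_mul])
    refine ⟨q, G z m / S z q, fun i => ?_⟩
    apply mul_right_cancel₀ hq
    rw [hrel]; ring
  choose τ e he using main
  have hinj : Function.Injective τ := by
    intro m m' h
    by_contra hne
    have e0 : e m' ≠ 0 := by
      intro h0; apply gz' m'; rw [he, h0, zero_mul]
    have h1 : ∀ j, G j m = e m / e m' * G j m' := by
      intro j; rw [he m j, he m' j, h]; field_simp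
    have h2 := gorth m m
    have h3 := gorth m m'
    rw [if_neg hne] at h3
    rw [if_pos rfl] at h2
    simp only [h1] at h2
    simp only [mul_left_comm _ (e m / e m'), ← Finset.mul_sum, h3, mul_zero] at h2
    exact one_ne_zero h2.symm
  have hee : ∀ m, e m ^ 2 = 1 := by
    intro m
    have h1 := gorth m m
    have h2 := horth (τ m) (τ m)
    rw [if_pos rfl] at h1 h2
    rw [← h1]
    simp only [sm_inv_symm σ G gsym gorth m]
    simp only [sm_inv_symm σ S hsym horth (τ m)] at h2
    simp only [he m]
    rw [← mul_one (e m ^ 2), ← h2, Finset.mul_sum]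
    exact Finset.sum_congr rfl fun j _ => by ring
  have hee' : ∀ m, ∃ w : ℤ, (w = 1 ∨ w = -1) ∧ e m = w := by
    intro m
    rcases sq_eq_one_iff.1 (hee m) with h | h
    · exact ⟨1, Or.inl rfl, by simp [h]⟩
    · exact ⟨-1, Or.inr rfl, by simp [h]⟩
  choose ε hε hεe using hee'
  refine ⟨Equiv.ofBijective τ (Finite.injective_iff_bijective.1 hinj), ε, hε, fun i j => ⟨?_, ?_⟩⟩
  · rw [gsym, he, hεe, hsym]; rfl
  · rw [he, hεe]; rfl

end

section
open IntermediateField in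
lemma sm_alg {I : Type*} [Fintype I] [DecidableEq I] (z : I) (σ : I → I) (S : Matrix I I ℂ)
    (hsym : ∀ i j, S i j = S j i) (horth : ∀ i l, ∑ j, S (σ i) j * S j l = if i = l then 1 else 0)
    (hz' : ∀ i, S z i ≠ 0)
    (n : I → I → I → ℕ) (hn : ∀ i k m, S i m * S k m = S z m * ∑ j, (n i k j : ℂ) * S j m) (i m : I) :
    IsIntegral ℚ (S i m) := by
  have h1 : ∀ i, IsIntegral ℚ (S i m / S z m) := by
    intro i
    refine isIntegral_of_smul_mem_submodule (A := ℂ) (M := ℂ) (Submodule.span ℚ (Set.range fun j => S j m / S z m)) ?_ 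
      (Submodule.fg_span (Set.finite_range _)) _ ?_
    · intro h
      have : (1 : ℂ) ∈ Submodule.span ℚ (Set.range fun j => S j m / S z m) :=
        Submodule.subset_span ⟨z, div_self (hz' m)⟩
      rw [h, Submodule.mem_bot] at this
      exact one_ne_zero this
    · intro x hx
      induction hx using Submodule.span_induction with
      | mem x hx =>
        obtain ⟨k, rfl⟩ := hx
        have : (S i m / S z m) • (S k m / S z m) = ∑ j, (n i k j : ℚ) • (S j m / S z m) := by
          rw [smul_eq_mul, div_mul_div_comm, hn]
          have : ∀ j, (n i k j : ℚ) • (S j m / S z m) = (n i k j : ℂ) * S j m / S z m := fun j => by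
            rw [Algebra.smul_def]; simp [mul_div_assoc]
          simp only [this]
          rw [← Finset.sum_div, mul_div_mul_left _ _ (hz' m)]
        simp only [this]
        exact Submodule.sum_mem _ fun j _ => Submodule.smul_mem _ _ (Submodule.subset_span ⟨j, rfl⟩)
      | zero => simp
      | add x y _ _ hx hy => rw [smul_add]; exact Submodule.add_mem _ hx hy
      | smul a x _ hx => rw [smul_comm]; exact Submodule.smul_mem _ _ hx
  have h2 : IsIntegral ℚ (S z m ^ 2) := by
    have h3 : (∑ j, (S (σ j) m / S z m) * (S j m / S z m)) * S z m ^ 2 = 1 := by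
      have := horth m m
      rw [if_pos rfl] at this
      rw [← this, Finset.sum_mul]
      refine Finset.sum_congr rfl fun j _ => ?_
      rw [sm_inv_symm σ S hsym horth m j]
      have := hz' m
      field_simp
    rw [eq_inv_of_mul_eq_one_right h3]
    exact IsIntegral.inv (IsIntegral.sum _ fun j _ => (h1 _).mul (h1 _))
  have h4 : S i m = (S i m / S z m) * S z m := by rw [div_mul_cancel₀ _ (hz' m)]
  rw [h4]
  exact (h1 i).mul (h2.of_pow (by norm_num))


end

theorem stmt12 (I : Type*) [Fintype I] [DecidableEq I] (z : I)
    (σ : I → I) (hσ : ∀ i, σ (σ i) = i)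
    (S : Matrix I I ℂ)
    (hsym : ∀ i j, S i j = S j i)
    (horth : ∀ i l, ∑ j, S (σ i) j * S j l = if i = l then 1 else 0)
    (hz : ∀ i, S z (σ i) = S z i) (hz' : ∀ i, S z i ≠ 0)
    (hN : ∀ i k j, ∃ n : ℕ,
      ∑ m, S i m * S k m * starRingEnd ℂ (S j m) / S z m = (n : ℂ)) :
    (∀ g : ℂ ≃+* ℂ, ∃ (τ : Equiv.Perm I) (ε : I → ℂ),
      (∀ i, ε i = 1 ∨ ε i = -1) ∧
      (∀ i j, g (S i j) = ε i * S (τ i) j ∧ g (S i j) = ε j * S i (τ j))) ∧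
    (∃ (n : ℕ) (ξ : ℂ), 0 < n ∧ ξ ^ n = 1 ∧
      ∀ i j, S i j ∈ Algebra.adjoin ℚ ({ξ} : Set ℂ)) := by
  have hU := sm_unitary z σ hσ S hsym horth hz' hN
  choose n hn' using hN
  have hn : ∀ i k m, S i m * S k m = S z m * ∑ j, (n i k j : ℂ) * S j m := by
    intro i k m
    have hU' : ∀ k j, ∑ m, S m k * starRingEnd ℂ (S m j) = if k = j then 1 else 0 := fun k j => by
      rw [← hU]; exact Finset.sum_congr rfl fun m _ => by rw [hsym m k, hsym m j]
    simp only [← hn', Finset.sum_mul]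
    rw [Finset.sum_comm]
    have h1 : ∀ r, ∑ j, S i r * S k r * starRingEnd ℂ (S j r) / S z r * S j m = if m = r then S i r * S k r / S z r else 0 := by
      intro r
      have := congrArg (S i r * S k r / S z r * ·) (hU' m r)
      simp only [Finset.mul_sum, mul_ite, mul_one, mul_zero] at this
      rw [← this]
      exact Finset.sum_congr rfl fun j _ => by ring
    simp only [h1]
    rw [Finset.sum_ite_eq, if_pos (Finset.mem_univ _), mul_div_cancel₀ _ (hz' m)]
  -- the permutation statement for two embeddings of one field
  have perm : ∀ (F : Type) [Field F] (ι g : F →+* ℂ) (s : I → I → F), (∀ i j, ι (s i j) = S i j) →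
      ∃ (τ : Equiv.Perm I) (ε : I → ℤ), (∀ i, ε i = 1 ∨ ε i = -1) ∧
      (∀ i j, g (s i j) = ε i * S (τ i) j ∧ g (s i j) = ε j * S i (τ j)) := by
    intro F _ ι g s hs
    refine sm_perm z σ S (fun i j => g (s i j)) hsym horth hz' hU n hn ?_ ?_ ?_ ?_
    · intro i j
      exact congrArg g (ι.injective (by rw [hs, hs, hsym]))
    · intro i l
      have : ∑ j, s (σ i) j * s j l = if i = l then 1 else 0 := by
        apply ι.injective
        rw [map_sum]
        simp only [map_mul, hs, horth]
        split_ifs <;> simp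
      have := congrArg g this
      rw [map_sum] at this
      simp only [map_mul] at this
      rw [this]
      split_ifs <;> simp
    · intro i h
      have h0 : s z i = 0 := (map_eq_zero g).1 h
      exact hz' i (by rw [← hs, h0, map_zero])
    · intro i k m
      have : s i m * s k m = s z m * ∑ j, (n i k j : F) * s j m := by
        apply ι.injective
        rw [map_mul, map_mul, map_sum]
        simp only [map_mul, hs, map_natCast, hn]
      have := congrArg g this
      rw [map_mul, map_mul, map_sum] at this
      simp only [map_mul, map_natCast] at this
      exact this
  constructor
  · intro g
    obtain ⟨τ, ε, h1, h2⟩ := perm ℂ (RingHom.id ℂ) (g : ℂ →+* ℂ) S (fun i j => rfl)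
    refine ⟨τ, fun i => (ε i : ℂ), fun i => ?_, h2⟩
    rcases h1 i with h | h <;> simp [h]
  -- the field generated by the entries
  let A : Set ℂ := Set.range fun q : I × I => S q.1 q.2
  obtain ⟨K, hKA⟩ : ∃ K : IntermediateField ℚ ℂ, K = IntermediateField.adjoin ℚ A := ⟨_, rfl⟩
  have hmem : ∀ i j, S i j ∈ K := fun i j => hKA ▸ IntermediateField.subset_adjoin ℚ A ⟨(i, j), rfl⟩
  have hAint : ∀ x ∈ A, IsIntegral ℚ x := by
    rintro _ ⟨q, rfl⟩
    exact sm_alg z σ S hsym horth hz' n hn _ _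
  haveI : FiniteDimensional ℚ K := by
    haveI : Finite A := Set.finite_range _
    rw [hKA]
    exact IntermediateField.finiteDimensional_adjoin hAint
  let s : I → I → K := fun i j => ⟨S i j, hmem i j⟩
  have hstab : ∀ f : K →ₐ[ℚ] ℂ, ∀ x : K, f x ∈ K := by
    intro f
    obtain ⟨τ, ε, h1, h2⟩ := perm K (algebraMap K ℂ) (f : K →+* ℂ) s (fun i j => rfl)
    have hA : IntermediateField.adjoin ℚ A ≤ K := hKA.ge
    have h3 : ∀ x (hx : x ∈ IntermediateField.adjoin ℚ A), f ⟨x, hA hx⟩ ∈ K := by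
      intro x hx
      induction hx using IntermediateField.adjoin_induction with
      | mem x hx =>
        obtain ⟨⟨i, j⟩, rfl⟩ := hx
        have h4 : f (s i j) = ε i * S (τ i) j := (h2 i j).1
        change f (s i j) ∈ K
        rw [h4]
        exact K.mul_mem (intCast_mem K _) (hmem _ _)
      | algebraMap x =>
        have : f (algebraMap ℚ K x) ∈ K := by rw [f.commutes]; exact K.algebraMap_mem x
        exact this
      | add x y hx hy h h' =>
        have := K.add_mem h h'
        rwa [← map_add] at this
      | inv x hx h =>
        have := K.inv_mem h
        rwa [← map_inv₀] at this
      | mul x y hx hy h h' =>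
        have := K.mul_mem h h'
        rwa [← map_mul] at this
    intro x
    exact h3 x (hKA ▸ x.2)
  haveI : Normal ℚ K := by
    rw [normal_iff]
    intro x
    have hx : IsIntegral ℚ x := Algebra.IsIntegral.isIntegral x
    refine ⟨hx, ?_⟩
    refine IntermediateField.splits_of_splits (IsAlgClosed.splits _) ?_
    intro y hy
    rw [← Algebra.IsAlgebraic.range_eval_eq_rootSet_minpoly (F := ℚ) (K := K) ℂ x] at hy
    obtain ⟨f, rfl⟩ := hy
    exact hstab f x
  haveI : IsGalois ℚ K := { }
  obtain ⟨N, ξ, h1, h2, h3⟩ := kronecker_weber K (by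
    intro a b
    have hact : ∀ a : K ≃ₐ[ℚ] K, ∃ (τ : I → I) (ε : I → ℤ), 
        ∀ i j, a (s i j) = ε i * s (τ i) j ∧ a (s i j) = ε j * s i (τ j) := by
      intro a
      obtain ⟨τ, ε, h1, h2⟩ := perm K (algebraMap K ℂ) ((algebraMap K ℂ).comp (a : K →+* K)) s (fun i j => rfl)
      refine ⟨τ, ε, fun i j => ⟨?_, ?_⟩⟩
      · apply (algebraMap K ℂ).injective
        rw [map_mul, map_intCast]
        exact (h2 i j).1
      · apply (algebraMap K ℂ).injective
        rw [map_mul, map_intCast]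
        exact (h2 i j).2
    obtain ⟨τ, ε, h⟩ := hact a
    obtain ⟨τ', ε', h'⟩ := hact b
    have : ((a * b : K ≃ₐ[ℚ] K) : K →ₐ[ℚ] K) = ((b * a : K ≃ₐ[ℚ] K) : K →ₐ[ℚ] K) := by
      refine IntermediateField.algHom_ext_of_eq_adjoin ℚ hKA ?_
      rintro _ ⟨⟨i, j⟩, rfl⟩
      change a (b (s i j)) = b (a (s i j))
      rw [(h' i j).2, (h i j).1, map_mul, map_mul, map_intCast, map_intCast, (h _ _).1, (h' _ _).2]
      ring
    apply AlgEquiv.ext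
    intro x; exact DFunLike.congr_fun this x)
  exact ⟨N, ξ, h1, h2, fun i j => h3 _ (hmem i j)⟩
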